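/- Let d ≥ 1, 1 < p < ∞, let Ω' ⊆ ℝ^d be a bounded open set, and let V be a bounded measurable function on Ω'. Let u, v ∈ C¹(Ω') ∩ C(closure(Ω')) be nonnegative, with v a weak supersolution and u a weak subsolution of -Δ_p w + V|w|^{p-2}w = 0 in Ω', v > 0 on the boundary ∂Ω', and u ≤ v on ∂Ω'. Let S := { x ∈ Ω' : ∇u(x) = 0 and ∇v(x) = 0 } and assume: (i) Ω' \ S is connected; (ii) the closure of S does not meet ∂Ω'. Assume moreover that the weak comparison principle holds in Ω': whenever ũ, ṽ ∈ C¹(Ω') ∩ C(closure(Ω')) are nonnegative, ṽ is a weak supersolution and ũ a weak subsolution of -Δ_p w + V|w|^{p-2}w = 0 in Ω', and ũ ≤ ṽ on ∂Ω', then ũ ≤ ṽ in Ω'. Then either u(x) < v(x) for every x ∈ Ω', or u(x) = v(x) for every x ∈ Ω'. -/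

import Mathlib

open MeasureTheory Metric Filter Topology Set
open scoped RealInnerProductSpace

noncomputable section

/-- `w` is a weak supersolution of `-Δ_p w + V|w|^{p-2}w = 0` in `Ω`. -/
def IsWeakSupersol {d : ℕ} (p : ℝ) (V : EuclideanSpace ℝ (Fin d) → ℝ)
    (Ω : Set (EuclideanSpace ℝ (Fin d))) (w : EuclideanSpace ℝ (Fin d) → ℝ) : Prop :=
  ∀ φ : EuclideanSpace ℝ (Fin d) → ℝ, ContDiff ℝ (⊤ : ℕ∞) φ → HasCompactSupport φ →
    tsupport φ ⊆ Ω → (∀ x, 0 ≤ φ x) →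
    0 ≤ ∫ x in Ω, (‖gradient w x‖ ^ (p - 2) * ⟪gradient w x, gradient φ x⟫ +
      V x * |w x| ^ (p - 2) * w x * φ x)

/-- `w` is a weak subsolution of `-Δ_p w + V|w|^{p-2}w = 0` in `Ω`. -/
def IsWeakSubsol {d : ℕ} (p : ℝ) (V : EuclideanSpace ℝ (Fin d) → ℝ)
    (Ω : Set (EuclideanSpace ℝ (Fin d))) (w : EuclideanSpace ℝ (Fin d) → ℝ) : Prop :=
  ∀ φ : EuclideanSpace ℝ (Fin d) → ℝ, ContDiff ℝ (⊤ : ℕ∞) φ → HasCompactSupport φ →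
    tsupport φ ⊆ Ω → (∀ x, 0 ≤ φ x) →
    ∫ x in Ω, (‖gradient w x‖ ^ (p - 2) * ⟪gradient w x, gradient φ x⟫ +
      V x * |w x| ^ (p - 2) * w x * φ x) ≤ 0

theorem lintegral_enorm_translate_sub_le {E : Type*} [NormedAddCommGroup E] [NormedSpace ℝ E]
    [FiniteDimensional ℝ E] [MeasurableSpace E] [BorelSpace E] {μ : Measure E}
    [μ.IsAddHaarMeasure] {f : E → ℝ} {U B K : Set E} (hU : IsOpen U) (hf : ContDiffOn ℝ 1 f U)
    (hB : MeasurableSet B) (hK : MeasurableSet K) (hKU : K ⊆ U) {h : E}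
    (hBK : ∀ x ∈ B, ∀ t ∈ Icc (0 : ℝ) 1, x + t • h ∈ K) :
    ∫⁻ x in B, ‖f (x + h) - f x‖ₑ ∂μ ≤ ‖h‖ₑ * ∫⁻ x in K, ‖fderiv ℝ f x‖ₑ ∂μ := by
  have hmeas : Measurable fun z : E × ℝ => ‖fderiv ℝ f (z.1 + z.2 • h)‖ₑ :=
    ((measurable_fderiv ℝ f).comp (by fun_prop)).enorm
  have hptw : ∀ x ∈ B, ‖f (x + h) - f x‖ₑ
      ≤ ‖h‖ₑ * ∫⁻ t in Ioc (0 : ℝ) 1, ‖fderiv ℝ f (x + t • h)‖ₑ := by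
    intro x hx
    have hcont : ContinuousOn (fun t : ℝ => fderiv ℝ f (x + t • h)) (Icc 0 1) :=
      (hf.continuousOn_fderiv_of_isOpen hU le_rfl).comp (by fun_prop)
        fun t ht => hKU (hBK x hx t ht)
    have hderiv : ∀ t ∈ uIcc (0 : ℝ) 1,
        HasDerivAt (fun t : ℝ => f (x + t • h)) (fderiv ℝ f (x + t • h) h) t := by
      intro t ht
      rw [uIcc_of_le zero_le_one] at ht
      have hd : HasFDerivAt f (fderiv ℝ f (x + t • h)) (x + t • h) :=
        ((hf.differentiableOn one_ne_zero).differentiableAt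
          (hU.mem_nhds (hKU (hBK x hx t ht)))).hasFDerivAt
      have hl : HasDerivAt (fun t : ℝ => x + t • h) h t := by
        simpa using ((hasDerivAt_id t).smul_const h).const_add x
      exact hd.comp_hasDerivAt t hl
    have hint : IntervalIntegrable (fun t : ℝ => fderiv ℝ f (x + t • h) h) volume 0 1 := by
      apply ContinuousOn.intervalIntegrable
      rw [uIcc_of_le zero_le_one]
      exact hcont.clm_apply continuousOn_const
    have hftc := intervalIntegral.integral_eq_sub_of_hasDerivAt hderiv hint
    simp only [one_smul, zero_smul, add_zero] at hftc
    rw [← hftc, intervalIntegral.integral_of_le zero_le_one]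
    calc _ ≤ ∫⁻ t in Ioc (0 : ℝ) 1, ‖fderiv ℝ f (x + t • h) h‖ₑ :=
          enorm_integral_le_lintegral_enorm _
      _ ≤ ∫⁻ t in Ioc (0 : ℝ) 1, ‖h‖ₑ * ‖fderiv ℝ f (x + t • h)‖ₑ := by
          refine lintegral_mono fun t => ?_
          rw [mul_comm]
          exact ContinuousLinearMap.le_opENorm _ _
      _ = _ := by
          exact lintegral_const_mul _ ((measurable_fderiv ℝ f).comp (by fun_prop)).enorm
  calc ∫⁻ x in B, ‖f (x + h) - f x‖ₑ ∂μ
      ≤ ∫⁻ x in B, (‖h‖ₑ * ∫⁻ t in Ioc (0 : ℝ) 1, ‖fderiv ℝ f (x + t • h)‖ₑ) ∂μ :=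
        setLIntegral_mono' hB hptw
    _ = ‖h‖ₑ * ∫⁻ t in Ioc (0 : ℝ) 1, (∫⁻ x in B, ‖fderiv ℝ f (x + t • h)‖ₑ ∂μ) := by
        rw [lintegral_const_mul, lintegral_lintegral_swap]
        · exact hmeas.aemeasurable
        · exact hmeas.lintegral_prod_right'
    _ ≤ ‖h‖ₑ * ∫⁻ t in Ioc (0 : ℝ) 1, (∫⁻ x in K, ‖fderiv ℝ f x‖ₑ ∂μ) := by
        refine mul_le_mul_right ?_ _
        refine setLIntegral_mono' measurableSet_Ioc fun t ht => ?_
        rw [← lintegral_indicator hB, ← lintegral_indicator hK,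
          ← lintegral_add_right_eq_self (K.indicator _) (t • h)]
        refine lintegral_mono fun x => ?_
        by_cases hx : x ∈ B
        · simp [hx, hBK x hx t (Ioc_subset_Icc_self ht)]
        · simp [hx]
    _ = _ := by simp

theorem lintegral_enorm_le_of_measure_support_le {E : Type*} [NormedAddCommGroup E]
    [NormedSpace ℝ E] [FiniteDimensional ℝ E] [MeasurableSpace E] [BorelSpace E] {μ : Measure E}
    [μ.IsAddHaarMeasure] {f : E → ℝ} (hf : ContDiff ℝ 1 f) {ρ : ℝ} (hρ : 0 < ρ)
    (hsupp : μ {x | f x ≠ 0} ≤ μ (ball 0 ρ) / 2) :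
    ∫⁻ x, ‖f x‖ₑ ∂μ ≤ 2 * ENNReal.ofReal ρ * ∫⁻ x, ‖fderiv ℝ f x‖ₑ ∂μ := by
  set m := μ (ball (0 : E) ρ) with hm
  have hm0 : m ≠ 0 := (measure_ball_pos μ 0 hρ).ne'
  have hmt : m ≠ ⊤ := measure_ball_lt_top.ne
  have hfc := hf.continuous
  have hptw : ∀ x, ‖f x‖ₑ * (m / 2) ≤ ∫⁻ h in ball 0 ρ, ‖f (x + h) - f x‖ₑ ∂μ := by
    intro x
    have hmz : MeasurableSet {h | f (x + h) ≠ 0} :=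
      (isOpen_ne_fun (by fun_prop) continuous_const).measurableSet
    have hE : μ {h | f (x + h) ≠ 0} ≤ m / 2 := by
      have := measure_preimage_add μ x {y | f y ≠ 0}
      simp only [preimage_ofPred_eq] at this
      rwa [this]
    have hG : m / 2 ≤ μ (ball 0 ρ \ {h | f (x + h) ≠ 0}) := by
      refine le_trans ?_ (le_measure_sdiff)
      calc m / 2 = m - m / 2 := (ENNReal.sub_half hmt).symm
        _ ≤ _ := tsub_le_tsub_left hE _
    calc ‖f x‖ₑ * (m / 2) ≤ ‖f x‖ₑ * μ (ball 0 ρ \ {h | f (x + h) ≠ 0}) := by gcongr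
      _ = ∫⁻ h in ball 0 ρ \ {h | f (x + h) ≠ 0}, ‖f x‖ₑ ∂μ := by simp
      _ ≤ ∫⁻ h in ball 0 ρ \ {h | f (x + h) ≠ 0}, ‖f (x + h) - f x‖ₑ ∂μ := by
          refine setLIntegral_mono' (measurableSet_ball.diff hmz) fun h hh => ?_
          have : f (x + h) = 0 := by simpa using hh.2
          simp [this]
      _ ≤ _ := lintegral_mono_set sdiff_subset
  have key : (∫⁻ x, ‖f x‖ₑ ∂μ) * (m / 2)
      ≤ (2 * ENNReal.ofReal ρ * ∫⁻ x, ‖fderiv ℝ f x‖ₑ ∂μ) * (m / 2) := by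
    calc (∫⁻ x, ‖f x‖ₑ ∂μ) * (m / 2) = ∫⁻ x, ‖f x‖ₑ * (m / 2) ∂μ := by
          rw [lintegral_mul_const _ (by fun_prop)]
      _ ≤ ∫⁻ x, ∫⁻ h in ball 0 ρ, ‖f (x + h) - f x‖ₑ ∂μ ∂μ := lintegral_mono hptw
      _ = ∫⁻ h in ball 0 ρ, ∫⁻ x, ‖f (x + h) - f x‖ₑ ∂μ ∂μ := by
          refine lintegral_lintegral_swap (Measurable.aemeasurable ?_)
          exact Continuous.measurable (by fun_prop)
      _ ≤ ∫⁻ h in ball (0 : E) ρ, ENNReal.ofReal ρ * ∫⁻ x, ‖fderiv ℝ f x‖ₑ ∂μ ∂μ := by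
          refine setLIntegral_mono' measurableSet_ball fun h hh => ?_
          have := lintegral_enorm_translate_sub_le (μ := μ) isOpen_univ hf.contDiffOn
            MeasurableSet.univ MeasurableSet.univ subset_rfl (h := h) (by simp)
          simp only [Measure.restrict_univ] at this
          refine this.trans ?_
          gcongr
          rw [← ofReal_norm]
          exact ENNReal.ofReal_le_ofReal ((mem_ball_zero_iff.1 hh).le)
      _ = ENNReal.ofReal ρ * (∫⁻ x, ‖fderiv ℝ f x‖ₑ ∂μ) * m := by simp [hm]
      _ = _ := by
          rw [show m = 2 * (m / 2) from (ENNReal.mul_div_cancel two_ne_zero (by simp)).symm]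
          rw [show 2 * (m / 2) / 2 = m / 2 by rw [ENNReal.mul_div_cancel two_ne_zero (by simp)]]
          ring
  refine (ENNReal.mul_le_mul_iff_left ?_ ?_).1 key
  · simpa using hm0
  · exact ENNReal.div_ne_top hmt two_ne_zero

theorem contDiff_indicator_of_eq_zero_off {E : Type*} [NormedAddCommGroup E] [NormedSpace ℝ E]
    {F : E → ℝ} {U K : Set E} (hU : IsOpen U) (hK : IsClosed K) (hKU : K ⊆ U)
    (hF : ContDiffOn ℝ 1 F U) (hFK : ∀ x ∈ U, x ∉ K → F x = 0) :
    ContDiff ℝ 1 (U.indicator F) := by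
  rw [contDiff_iff_contDiffAt]
  intro x
  by_cases hx : x ∈ U
  · refine (hF.contDiffAt (hU.mem_nhds hx)).congr_of_eventuallyEq ?_
    filter_upwards [hU.mem_nhds hx] with y hy
    simp [hy]
  · refine (contDiffAt_const (c := (0 : ℝ))).congr_of_eventuallyEq ?_
    filter_upwards [hK.isOpen_compl.mem_nhds (fun h => hx (hKU h))] with y hy
    by_cases hyU : y ∈ U
    · simp [hyU, hFK y hyU hy]
    · simp [hyU]

theorem fderiv_indicator_of_mem {E : Type*} [NormedAddCommGroup E] [NormedSpace ℝ E]
    {F : E → ℝ} {U : Set E} (hU : IsOpen U) {x : E} (hx : x ∈ U) :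
    fderiv ℝ (U.indicator F) x = fderiv ℝ F x := by
  refine Filter.EventuallyEq.fderiv_eq ?_
  filter_upwards [hU.mem_nhds hx] with y hy
  simp [hy]

open scoped Convolution in
theorem fderiv_normed_convolution {E : Type*} [NormedAddCommGroup E] [NormedSpace ℝ E]
    [FiniteDimensional ℝ E] [MeasurableSpace E] [BorelSpace E] {μ : Measure E}
    [μ.IsAddHaarMeasure] {φ : E → ℝ} (hφ : ContDiff ℝ 1 φ) (hc : HasCompactSupport φ)
    (b : ContDiffBump (0 : E)) (x : E) :
    fderiv ℝ (b.normed μ ⋆[ContinuousLinearMap.lsmul ℝ ℝ, μ] φ) x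
      = (b.normed μ ⋆[ContinuousLinearMap.lsmul ℝ ℝ, μ] fderiv ℝ φ) x := by
  have hb : LocallyIntegrable (b.normed μ) μ := b.continuous_normed.locallyIntegrable
  rw [(hc.hasFDerivAt_convolution_right (ContinuousLinearMap.lsmul ℝ ℝ) hb hφ x).fderiv]
  rfl

open scoped Convolution in
/-- A weak inequality against smooth test functions extends to `C¹` test functions. -/
theorem integral_nonneg_of_forall_smooth_test {E : Type*} [NormedAddCommGroup E]
    [NormedSpace ℝ E] [FiniteDimensional ℝ E] [MeasurableSpace E] [BorelSpace E] {μ : Measure E}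
    [μ.IsAddHaarMeasure] {Ω U : Set E} (hΩ : IsOpen Ω) (hU : IsOpen U) (hUΩ : U ⊆ Ω)
    {G : E → E} {B : E → ℝ} (hG : ContinuousOn G Ω)
    (hB : AEStronglyMeasurable B (μ.restrict Ω))
    (hBb : ∀ K ⊆ Ω, IsCompact K → ∃ M, ∀ x ∈ K, |B x| ≤ M)
    (htest : ∀ φ : E → ℝ, ContDiff ℝ (⊤ : ℕ∞) φ → HasCompactSupport φ → tsupport φ ⊆ Ω →
      (∀ x, 0 ≤ φ x) → 0 ≤ ∫ x in Ω, (fderiv ℝ φ x (G x) + B x * φ x) ∂μ)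
    {F : E → ℝ} (hF : ContDiffOn ℝ 1 F U) (hF0 : ∀ x ∈ U, 0 ≤ F x) {K : Set E}
    (hK : IsCompact K) (hKU : K ⊆ U) (hFK : ∀ x ∈ U, x ∉ K → F x = 0) :
    0 ≤ ∫ x in U, (fderiv ℝ F x (G x) + B x * F x) ∂μ := by
  set φ := U.indicator F with hφdef
  have hφ : ContDiff ℝ 1 φ := contDiff_indicator_of_eq_zero_off hU hK.isClosed hKU hF hFK
  have hφK : ∀ x, x ∉ K → φ x = 0 := by
    intro x hx
    by_cases hxU : x ∈ U
    · simp [φ, hxU, hFK x hxU hx]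
    · simp [φ, hxU]
  have hφ0 : ∀ x, 0 ≤ φ x := fun x => indicator_nonneg hF0 x
  have hφc : HasCompactSupport φ := HasCompactSupport.intro hK hφK
  have hts : tsupport φ ⊆ K :=
    closure_minimal (fun x hx => by_contra fun h => hx (hφK x h)) hK.isClosed
  have hφ' : ∀ x, x ∉ K → fderiv ℝ φ x = 0 := fun x hx =>
    fderiv_of_notMem_tsupport ℝ fun h => hx (hts h)
  have hconv : ∫ x in U, (fderiv ℝ F x (G x) + B x * F x) ∂μ
      = ∫ x in Ω, (fderiv ℝ φ x (G x) + B x * φ x) ∂μ := by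
    rw [setIntegral_eq_of_subset_of_forall_sdiff_eq_zero hΩ.measurableSet hUΩ]
    · refine setIntegral_congr_fun hU.measurableSet fun x hx => ?_
      simp only [φ, fderiv_indicator_of_mem hU hx, indicator_of_mem hx]
    · intro x hx
      have : x ∉ K := fun h => hx.2 (hKU h)
      simp [hφ' x this, hφK x this]
  rw [hconv]
  obtain ⟨δ, hδ, hδΩ⟩ := hK.exists_cthickening_subset_open hΩ (hKU.trans hUΩ)
  set K' := cthickening δ K with hK'def
  have hK' : IsCompact K' := hK.cthickening
  set b : ℕ → ContDiffBump (0 : E) := fun n =>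
    ⟨δ / (n + 2) / 2, δ / (n + 2), by positivity, by
      have : 0 < δ / (n + 2) := by positivity
      linarith⟩ with hb
  have hbr : ∀ n, (b n).rOut ≤ δ := fun n => by
    show δ / (n + 2) ≤ δ
    apply div_le_self hδ.le
    have : (0 : ℝ) ≤ n := Nat.cast_nonneg n
    linarith
  have hbt : Tendsto (fun n => (b n).rOut) atTop (𝓝 0) := by
    show Tendsto (fun n : ℕ => δ / ((n : ℝ) + 2)) atTop (𝓝 0)
    exact tendsto_const_nhds.div_atTop
      (tendsto_atTop_add_const_right _ _ tendsto_natCast_atTop_atTop)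
  set ψ : ℕ → E → ℝ := fun n => (b n).normed μ ⋆[ContinuousLinearMap.lsmul ℝ ℝ, μ] φ with hψ
  have hψs : ∀ n, ContDiff ℝ (⊤ : ℕ∞) (ψ n) := fun n =>
    (b n).hasCompactSupport_normed.contDiff_convolution_left _ (b n).contDiff_normed
      hφ.continuous.locallyIntegrable
  have hψ0 : ∀ n x, 0 ≤ ψ n x := fun n x => integral_nonneg fun t => by
    simpa using mul_nonneg ((b n).nonneg_normed t) (hφ0 _)
  have hball : ∀ x, x ∉ K' → ∀ y ∈ ball x δ, y ∉ K := by
    intro x hx y hy hyK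
    exact hx (mem_cthickening_of_dist_le x y δ K hyK (by
      rw [dist_comm]; exact (mem_ball.1 hy).le))
  have hψK : ∀ n x, x ∉ K' → ψ n x = 0 := by
    intro n x hx
    have h0 : φ x = 0 := hφK x (hball x hx x (mem_ball_self hδ))
    have := (b n).normed_convolution_eq_right (μ := μ) (g := φ) (x₀ := x) fun y hy => by
      rw [h0, hφK y (hball x hx y (ball_subset_ball (hbr n) hy))]
    rw [h0] at this
    exact this
  have hψts : ∀ n, tsupport (ψ n) ⊆ K' := fun n =>
    closure_minimal (fun x hx => by_contra fun h => hx (hψK n x h)) hK'.isClosed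
  have hψc : ∀ n, HasCompactSupport (ψ n) := fun n => HasCompactSupport.intro hK' (hψK n)
  have hψ'K : ∀ n x, x ∉ K' → fderiv ℝ (ψ n) x = 0 := fun n x hx =>
    fderiv_of_notMem_tsupport ℝ fun h => hx (hψts n h)
  have hφ'c : Continuous (fderiv ℝ φ) := hφ.continuous_fderiv one_ne_zero
  obtain ⟨C₀, hC₀⟩ := hφ.continuous.bounded_above_of_compact_support hφc
  obtain ⟨C₁, hC₁⟩ := hφ'c.bounded_above_of_compact_support (hφc.fderiv ℝ)
  have hψb : ∀ n x, ‖ψ n x‖ ≤ 3 * C₀ := by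
    intro n x
    have := (b n).dist_normed_convolution_le (μ := μ) (g := φ) (x₀ := x) (ε := 2 * C₀)
      hφ.continuous.aestronglyMeasurable (fun y _ => by
        rw [dist_eq_norm]; linarith [norm_sub_le (φ y) (φ x), hC₀ x, hC₀ y])
    rw [dist_eq_norm] at this
    have h2 := norm_le_norm_add_norm_sub' (ψ n x) (φ x)
    linarith [hC₀ x]
  have hψ'b : ∀ n x, ‖fderiv ℝ (ψ n) x‖ ≤ 3 * C₁ := by
    intro n x
    have := (b n).dist_normed_convolution_le (μ := μ) (g := fderiv ℝ φ) (x₀ := x) (ε := 2 * C₁)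
      hφ'c.aestronglyMeasurable (fun y _ => by
        rw [dist_eq_norm]; linarith [norm_sub_le (fderiv ℝ φ y) (fderiv ℝ φ x), hC₁ x, hC₁ y])
    rw [dist_eq_norm, ← fderiv_normed_convolution hφ hφc] at this
    have h2 := norm_le_norm_add_norm_sub' (fderiv ℝ (ψ n) x) (fderiv ℝ φ x)
    linarith [hC₁ x]
  obtain ⟨M₀, hM₀⟩ := hBb K' hδΩ hK'
  obtain ⟨M₁, hM₁⟩ := hK'.exists_bound_of_continuousOn (hG.mono hδΩ)
  have hlim : Tendsto (fun n => ∫ x in Ω, (fderiv ℝ (ψ n) x (G x) + B x * ψ n x) ∂μ) atTop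
      (𝓝 (∫ x in Ω, (fderiv ℝ φ x (G x) + B x * φ x) ∂μ)) := by
    refine tendsto_integral_of_dominated_convergence
      (K'.indicator fun _ => 3 * C₁ * M₁ + M₀ * (3 * C₀)) ?_ ?_ ?_ ?_
    · intro n
      have h1 : ContinuousOn (fun x => fderiv ℝ (ψ n) x (G x)) Ω :=
        ((hψs n).continuous_fderiv (by simp)).continuousOn.clm_apply hG
      exact (h1.aestronglyMeasurable hΩ.measurableSet).add
        (hB.mul (hψs n).continuous.aestronglyMeasurable)
    · refine (IntegrableOn.integrable_indicator ?_ hK'.measurableSet)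
      exact integrableOn_const (by
        refine ((Measure.restrict_apply_le _ _).trans_lt hK'.measure_lt_top).ne)
    · refine fun n => Eventually.of_forall fun x => ?_
      by_cases hx : x ∈ K'
      · rw [indicator_of_mem hx]
        refine (norm_add_le _ _).trans (add_le_add ?_ ?_)
        · exact (ContinuousLinearMap.le_opNorm _ _).trans
            (mul_le_mul (hψ'b n x) (hM₁ x hx) (norm_nonneg _) ((norm_nonneg _).trans (hψ'b n x)))
        · rw [norm_mul]
          exact mul_le_mul (hM₀ x hx) (hψb n x) (norm_nonneg _) ((abs_nonneg _).trans (hM₀ x hx))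
      · simp [hx, hψ'K n x hx, hψK n x hx]
    · refine Eventually.of_forall fun x => ?_
      have h1 : Tendsto (fun n => ψ n x) atTop (𝓝 (φ x)) :=
        ContDiffBump.convolution_tendsto_right_of_continuous hbt hφ.continuous x
      have h2 : Tendsto (fun n => fderiv ℝ (ψ n) x) atTop (𝓝 (fderiv ℝ φ x)) := by
        simp only [hψ, fderiv_normed_convolution hφ hφc]
        exact ContDiffBump.convolution_tendsto_right_of_continuous hbt hφ'c x
      exact (((ContinuousLinearMap.apply ℝ ℝ (G x)).continuous.tendsto _).comp h2).add (h1.const_mul _)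
  exact ge_of_tendsto' hlim fun n =>
    htest (ψ n) (hψs n) (hψc n) ((hψts n).trans hδΩ) (hψ0 n)

theorem hasDerivAt_max_zero_sq (t : ℝ) :
    HasDerivAt (fun t : ℝ => max t 0 ^ 2) (2 * max t 0) t := by
  rcases lt_trichotomy t 0 with ht | rfl | ht
  · rw [max_eq_right ht.le, mul_zero]
    refine (hasDerivAt_const t (0 : ℝ)).congr_of_eventuallyEq ?_
    filter_upwards [Iio_mem_nhds ht] with y hy
    simp [max_eq_right (le_of_lt (mem_Iio.1 hy))]
  · rw [hasDerivAt_iff_isLittleO_nhds_zero]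
    have h1 : (fun h : ℝ => h ^ 2) =o[𝓝 0] fun h : ℝ => h := by
      simpa using Asymptotics.isLittleO_pow_pow (𝕜 := ℝ) (m := 1) (n := 2) (by norm_num)
    refine Asymptotics.IsBigO.trans_isLittleO ?_ h1
    refine Asymptotics.IsBigO.of_bound 1 (Eventually.of_forall fun h => ?_)
    simp only [zero_add, max_self, ne_eq, OfNat.ofNat_ne_zero, not_false_eq_true, zero_pow,
      mul_zero, smul_eq_mul, sub_zero, one_mul]
    rw [Real.norm_of_nonneg (sq_nonneg _), Real.norm_of_nonneg (sq_nonneg _)]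
    rcases le_total h 0 with h0 | h0
    · rw [max_eq_right h0, zero_pow two_ne_zero]; exact sq_nonneg h
    · rw [max_eq_left h0]
  · rw [max_eq_left ht.le]
    have := hasDerivAt_pow 2 t
    simp only [Nat.cast_ofNat, Nat.add_one_sub_one, pow_one] at this
    refine this.congr_of_eventuallyEq ?_
    filter_upwards [Ioi_mem_nhds ht] with y hy
    simp [max_eq_left (le_of_lt (mem_Ioi.1 hy))]

theorem contDiff_max_zero_sq : ContDiff ℝ 1 (fun t : ℝ => max t 0 ^ 2) := by
  rw [contDiff_one_iff_deriv]
  refine ⟨fun t => (hasDerivAt_max_zero_sq t).differentiableAt, ?_⟩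
  rw [show deriv (fun t : ℝ => max t 0 ^ 2) = fun t => 2 * max t 0 from
    funext fun t => (hasDerivAt_max_zero_sq t).deriv]
  fun_prop

/-- A form of Young's inequality. -/
theorem exists_forall_mul_rpow_le {q : ℝ} (hq : 1 < q) {L δ : ℝ} (hL : 0 ≤ L) (hδ : 0 < δ) :
    ∃ C, 0 ≤ C ∧ ∀ k T : ℝ, 0 ≤ k → 0 ≤ T →
      k * L * T ^ (q - 1) ≤ δ * T ^ q + C * k ^ q := by
  refine ⟨L * (L / δ) ^ (q - 1), by positivity, fun k T hk hT => ?_⟩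
  have hsplit : ∀ t : ℝ, 0 ≤ t → t * t ^ (q - 1) = t ^ q := by
    intro t ht
    rcases ht.eq_or_lt with rfl | ht
    · rw [zero_mul, Real.zero_rpow (by linarith)]
    · rw [Real.rpow_sub_one ht.ne']; field_simp
  rcases le_total T (L / δ * k) with h | h
  · have h1 : T ^ (q - 1) ≤ (L / δ) ^ (q - 1) * k ^ (q - 1) := by
      rw [← Real.mul_rpow (by positivity) hk]
      exact Real.rpow_le_rpow hT h (by linarith)
    calc k * L * T ^ (q - 1) ≤ k * L * ((L / δ) ^ (q - 1) * k ^ (q - 1)) := by gcongr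
      _ = L * (L / δ) ^ (q - 1) * (k * k ^ (q - 1)) := by ring
      _ = L * (L / δ) ^ (q - 1) * k ^ q := by rw [hsplit k hk]
      _ ≤ _ := le_add_of_nonneg_left (by positivity)
  · have h1 : k * L ≤ δ * T := by
      have := mul_le_mul_of_nonneg_left h hδ.le
      rwa [← mul_assoc, mul_div_cancel₀ _ hδ.ne', mul_comm L] at this
    calc k * L * T ^ (q - 1) ≤ δ * T * T ^ (q - 1) := by gcongr
      _ = δ * T ^ q := by rw [mul_assoc, hsplit T hT]
      _ ≤ _ := le_add_of_nonneg_right (by positivity)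

theorem integrableOn_of_continuousOn_of_eq_zero_off {E : Type*} [NormedAddCommGroup E]
    [NormedSpace ℝ E] [MeasurableSpace E] [BorelSpace E] {μ : Measure E}
    [IsFiniteMeasureOnCompacts μ] {X : E → ℝ} {U K : Set E} (hU : IsOpen U) (hK : IsCompact K)
    (hKU : K ⊆ U) (hX : ContinuousOn X U) (hXK : ∀ x ∈ U, x ∉ K → X x = 0) :
    IntegrableOn X U μ :=
  ((hX.mono hKU).integrableOn_compact hK).of_forall_sdiff_eq_zero hU.measurableSet
    fun x hx => hXK x hx.1 hx.2

/-- `w` is a nonnegative `C¹` solution in `U` of `-div A + C w ^ (q - 1) ≥ 0` in the weak sense,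
for a flux `A` with `q`-growth and `q`-coercivity with respect to the derivative of `w`. -/
structure IsQuasilinearSupersol {E : Type*} [NormedAddCommGroup E] [NormedSpace ℝ E]
    [MeasurableSpace E] (μ : Measure E) (q c C : ℝ) (U : Set E) (w : E → ℝ) (A : E → E) :
    Prop where
  isOpen : IsOpen U
  contDiffOn : ContDiffOn ℝ 1 w U
  nonneg : ∀ x ∈ U, 0 ≤ w x
  continuousOn_flux : ContinuousOn A U
  coercive : ∀ x ∈ U, c * ‖fderiv ℝ w x‖ ^ q ≤ fderiv ℝ w x (A x)
  growth : ∀ x ∈ U, ‖A x‖ ≤ C * ‖fderiv ℝ w x‖ ^ (q - 1)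
  weak : ∀ (F : E → ℝ) (K : Set E), ContDiffOn ℝ 1 F U → (∀ x ∈ U, 0 ≤ F x) → IsCompact K →
    K ⊆ U → (∀ x ∈ U, x ∉ K → F x = 0) →
    0 ≤ ∫ x in U, (fderiv ℝ F x (A x) + C * w x ^ (q - 1) * F x) ∂μ

theorem fderiv_eq_zero_of_eq_zero_off {E : Type*} [NormedAddCommGroup E] [NormedSpace ℝ E]
    {F : E → ℝ} {U K : Set E} (hU : IsOpen U) (hK : IsClosed K)
    (hFK : ∀ x ∈ U, x ∉ K → F x = 0) {x : E} (hx : x ∈ U) (hxK : x ∉ K) : fderiv ℝ F x = 0 := by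
  have : F =ᶠ[𝓝 x] fun _ => (0 : ℝ) := by
    filter_upwards [(hU.inter hK.isOpen_compl).mem_nhds ⟨hx, hxK⟩] with y hy
    exact hFK y hy.1 hy.2
  rw [this.fderiv_eq]
  simp

namespace IsQuasilinearSupersol

variable {E : Type*} [NormedAddCommGroup E] [NormedSpace ℝ E] [MeasurableSpace E] [BorelSpace E]
  {μ : Measure E} {q c C : ℝ} {U : Set E} {w : E → ℝ} {A : E → E}

theorem integrableOn_test [IsFiniteMeasureOnCompacts μ] (hw : IsQuasilinearSupersol μ q c C U w A)
    (hq : 1 < q)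
    {F : E → ℝ} {K : Set E} (hF : ContDiffOn ℝ 1 F U) (hK : IsCompact K)
    (hKU : K ⊆ U) (hFK : ∀ x ∈ U, x ∉ K → F x = 0) :
    IntegrableOn (fun x => fderiv ℝ F x (A x) + C * w x ^ (q - 1) * F x) U μ := by
  refine integrableOn_of_continuousOn_of_eq_zero_off hw.isOpen hK hKU ?_ ?_
  · have h1 := hF.continuousOn_fderiv_of_isOpen hw.isOpen le_rfl
    have h2 : ContinuousOn (fun x => w x ^ (q - 1)) U :=
      hw.contDiffOn.continuousOn.rpow_const fun x _ => Or.inr (by linarith)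
    exact (h1.clm_apply hw.continuousOn_flux).add
      ((continuousOn_const.mul h2).mul hF.continuousOn)
  · intro x hx hxK
    simp [fderiv_eq_zero_of_eq_zero_off hw.isOpen hK.isClosed hFK hx hxK, hFK x hx hxK]

/-- Energy estimate for truncations of `w` from above by multiples of a bump function. -/
theorem exists_lintegral_fderiv_truncation_le [FiniteDimensional ℝ E] [IsFiniteMeasureOnCompacts μ]
    (hw : IsQuasilinearSupersol μ q c C U w A) (hq : 1 < q) (hc : 0 < c) (hC : 0 ≤ C)
    {x₀ : E} (b : ContDiffBump x₀) (hb : closedBall x₀ b.rOut ⊆ U) :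
    ∃ C', 0 ≤ C' ∧ ∀ k τ : ℝ, 0 < k → 0 ≤ τ →
      ContDiff ℝ 1 (U.indicator fun x => max (b x - w x / k - τ) 0 ^ 2) ∧
      ∫⁻ x, ‖fderiv ℝ (U.indicator fun x => max (b x - w x / k - τ) 0 ^ 2) x‖ₑ ∂μ
        ≤ ENNReal.ofReal C' * μ {x ∈ U | τ < b x - w x / k} := by
  obtain ⟨Λ, hΛ⟩ := (b.contDiff (n := 1)).continuous_fderiv one_ne_zero
    |>.bounded_above_of_compact_support (b.hasCompactSupport.fderiv ℝ)
  have hΛ0 : 0 ≤ Λ := (norm_nonneg _).trans (hΛ x₀)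
  obtain ⟨C₁, hC₁, hyoung⟩ := exists_forall_mul_rpow_le hq (mul_nonneg hΛ0 hC) (half_pos hc)
  refine ⟨2 * Λ + 2 + 2 * (2 * C₁ + C) / c, by positivity, fun k τ hk hτ => ?_⟩
  set F : E → ℝ := fun x => max (b x - w x / k - τ) 0 ^ 2 with hFdef
  set Z := {x ∈ U | τ < b x - w x / k} with hZ
  have hθ : ContDiffOn ℝ 1 (fun x => b x - w x / k - τ) U :=
    (b.contDiff.contDiffOn.sub (hw.contDiffOn.div_const k)).sub contDiffOn_const
  have hF : ContDiffOn ℝ 1 F U := contDiff_max_zero_sq.comp_contDiffOn hθ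
  have hK : IsCompact (closedBall x₀ b.rOut) := isCompact_closedBall _ _
  have hoff : ∀ x ∈ U, x ∉ closedBall x₀ b.rOut → b x - w x / k - τ ≤ 0 := by
    intro x hx hxK
    have h1 : b x = 0 := b.zero_of_le_dist (le_of_lt (by simpa using hxK))
    have h2 : 0 ≤ w x / k := div_nonneg (hw.nonneg x hx) hk.le
    linarith
  have hFK : ∀ x ∈ U, x ∉ closedBall x₀ b.rOut → F x = 0 := by
    intro x hx hxK
    simp [F, max_eq_right (hoff x hx hxK)]
  have hder : ∀ x ∈ U, fderiv ℝ F x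
      = (2 * max (b x - w x / k - τ) 0) • (fderiv ℝ b x - k⁻¹ • fderiv ℝ w x) := by
    intro x hx
    have hwd : HasFDerivAt w (fderiv ℝ w x) x :=
      ((hw.contDiffOn.differentiableOn one_ne_zero).differentiableAt
        (hw.isOpen.mem_nhds hx)).hasFDerivAt
    have hbd : HasFDerivAt b (fderiv ℝ b x) x :=
      (b.contDiff (n := 1)).differentiable one_ne_zero x |>.hasFDerivAt
    have h1 : HasFDerivAt (fun x => b x - w x / k - τ)
        (fderiv ℝ b x - k⁻¹ • fderiv ℝ w x) x := by
      simp only [div_eq_inv_mul]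
      exact (hbd.sub (hwd.const_mul k⁻¹)).sub_const τ
    exact ((hasDerivAt_max_zero_sq _).comp_hasFDerivAt x h1).fderiv
  have hcd := contDiff_indicator_of_eq_zero_off hw.isOpen hK.isClosed hb hF hFK
  refine ⟨hcd, ?_⟩
  have hXint := hw.integrableOn_test hq hF hK hb hFK
  have hX0 := hw.weak F _ hF (fun x _ => sq_nonneg _) hK hb hFK
  set X : E → ℝ := fun x => fderiv ℝ F x (A x) + C * w x ^ (q - 1) * F x with hX
  have hDint : IntegrableOn (fun x => ‖fderiv ℝ F x‖) U μ :=
    integrableOn_of_continuousOn_of_eq_zero_off hw.isOpen hK hb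
      (hF.continuousOn_fderiv_of_isOpen hw.isOpen le_rfl).norm
      fun x hx hxK => by
        simp [fderiv_eq_zero_of_eq_zero_off hw.isOpen hK.isClosed hFK hx hxK]
  have hZm : MeasurableSet Z := by
    have : IsOpen (U ∩ (fun x => b x - w x / k - τ) ⁻¹' Ioi 0) :=
      hθ.continuousOn.isOpen_inter_preimage hw.isOpen isOpen_Ioi
    convert this.measurableSet using 1
    ext x; simp [Z, sub_pos]
  have hZK : Z ⊆ closedBall x₀ b.rOut := by
    intro x hx
    by_contra h
    have := hoff x hx.1 h
    linarith [hx.2]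
  have hZfin : μ Z ≠ ⊤ := ((measure_mono hZK).trans_lt hK.measure_lt_top).ne
  set κ := 2 * k / (c * k ^ q) with hκ
  have hκ0 : 0 ≤ κ := by positivity
  set C₄ := 2 * Λ + 2 + 2 * (2 * C₁ + C) / c with hC₄
  have hptw : ∀ x ∈ U, ‖fderiv ℝ F x‖ ≤ Z.indicator (fun _ => C₄) x - κ * X x := by
    intro x hx
    by_cases hxZ : x ∈ Z
    · rw [indicator_of_mem hxZ]
      have hN0 : 0 < b x - w x / k - τ := by linarith [hxZ.2]
      set N := b x - w x / k - τ with hN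
      have hwk : w x < k := by
        have : w x / k < 1 := by linarith [b.le_one (x := x)]
        rwa [div_lt_one hk] at this
      have hw0 := hw.nonneg x hx
      have hN1 : N ≤ 1 := by
        have := div_nonneg hw0 hk.le
        linarith [b.le_one (x := x)]
      set T := ‖fderiv ℝ w x‖ with hT
      have hT0 : 0 ≤ T := norm_nonneg _
      have hd := hder x hx
      rw [← hN, max_eq_left hN0.le] at hd
      have hkq : 0 < k ^ q := Real.rpow_pos_of_pos hk q
      have hX1 : k * X x ≤ N * (-(c * T ^ q) + (2 * C₁ + C) * k ^ q) := by
        have e1 : k * X x = 2 * N * (k * fderiv ℝ b x (A x) - fderiv ℝ w x (A x))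
            + C * (k * w x ^ (q - 1)) * N ^ 2 := by
          simp only [hX, hFdef, ← hN, max_eq_left hN0.le]
          rw [hd]
          simp only [_root_.smul_apply, _root_.sub_apply, smul_eq_mul]
          field_simp
        have e2 : k * fderiv ℝ b x (A x) ≤ k * (Λ * C) * T ^ (q - 1) := by
          have : fderiv ℝ b x (A x) ≤ Λ * (C * T ^ (q - 1)) :=
            (le_abs_self _).trans <| (ContinuousLinearMap.le_opNorm _ _).trans <|
              mul_le_mul (hΛ x) (hw.growth x hx) (norm_nonneg _) hΛ0
          calc _ ≤ k * (Λ * (C * T ^ (q - 1))) := by gcongr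
            _ = _ := by ring
        have e3 := hyoung k T hk.le hT0
        have e4 := hw.coercive x hx
        have e5 : k * w x ^ (q - 1) ≤ k ^ q := by
          calc k * w x ^ (q - 1) ≤ k * k ^ (q - 1) := by
                gcongr
            _ = k ^ q := by rw [Real.rpow_sub_one hk.ne']; field_simp
        have e6 : C * (k * w x ^ (q - 1)) * N ^ 2 ≤ C * k ^ q * N := by
          have : N ^ 2 ≤ N := by nlinarith
          have hw' : 0 ≤ w x ^ (q - 1) := Real.rpow_nonneg hw0 _
          gcongr
        rw [e1]
        have e7 : 2 * N * (k * fderiv ℝ b x (A x) - fderiv ℝ w x (A x))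
            ≤ 2 * N * (c / 2 * T ^ q + C₁ * k ^ q - c * T ^ q) := by
          gcongr
          linarith
        linarith
      have hD1 : ‖fderiv ℝ F x‖ ≤ 2 * N * (Λ + (1 + T ^ q / k ^ q)) := by
        rw [hd, norm_smul, Real.norm_of_nonneg (by positivity)]
        gcongr
        refine (norm_sub_le _ _).trans (add_le_add (hΛ x) ?_)
        rw [norm_smul, norm_inv, Real.norm_of_nonneg hk.le, ← hT, ← Real.div_rpow hT0 hk.le,
          ← div_eq_inv_mul]
        rcases le_total (T / k) 1 with h | h
        · have : 0 ≤ (T / k) ^ q := by positivity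
          linarith
        · have := Real.rpow_le_rpow_of_exponent_le h hq.le
          rw [Real.rpow_one] at this
          linarith
      have hκX : κ * X x ≤ 2 / (c * k ^ q) * (N * (-(c * T ^ q) + (2 * C₁ + C) * k ^ q)) := by
        calc κ * X x = 2 / (c * k ^ q) * (k * X x) := by rw [hκ]; ring
          _ ≤ _ := by gcongr
      have e8 : 2 / (c * k ^ q) * (N * (-(c * T ^ q) + (2 * C₁ + C) * k ^ q))
          = -(2 * N * (T ^ q / k ^ q)) + N * (2 * (2 * C₁ + C) / c) := by
        field_simp
      have e9 : N * C₄ ≤ C₄ := mul_le_of_le_one_left (by positivity) hN1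
      rw [hC₄] at e9 ⊢
      nlinarith
    · rw [indicator_of_notMem hxZ]
      have h0 : b x - w x / k - τ ≤ 0 := by
        by_contra h
        exact hxZ ⟨hx, by linarith⟩
      have hd := hder x hx
      rw [max_eq_right h0] at hd
      simp only [mul_zero, zero_smul] at hd
      have hFx : F x = 0 := by simp [hFdef, max_eq_right h0]
      simp only [hX]
      rw [hd, hFx]
      simp
  have hint : ∫ x in U, ‖fderiv ℝ F x‖ ∂μ ≤ C₄ * μ.real Z := by
    have hi : IntegrableOn (Z.indicator fun _ => C₄) U μ :=
      ((integrable_indicator_iff hZm).2 (integrableOn_const hZfin)).integrableOn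
    calc ∫ x in U, ‖fderiv ℝ F x‖ ∂μ ≤ ∫ x in U, (Z.indicator (fun _ => C₄) x - κ * X x) ∂μ :=
          setIntegral_mono_on hDint (hi.sub (hXint.const_mul κ)) hw.isOpen.measurableSet hptw
      _ = C₄ * μ.real Z - κ * ∫ x in U, X x ∂μ := by
          rw [integral_sub hi (hXint.const_mul κ), integral_const_mul,
            setIntegral_indicator hZm, inter_eq_self_of_subset_right fun x hx => hx.1]
          simp [mul_comm]
      _ ≤ _ := sub_le_self _ (mul_nonneg hκ0 hX0)
  have hsupp : ∀ x, x ∉ U → fderiv ℝ (U.indicator F) x = 0 := by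
    intro x hx
    refine fderiv_eq_zero_of_eq_zero_off isOpen_univ hK.isClosed (U := univ) ?_ (mem_univ x)
      fun h => hx (hb h)
    intro y _ hy
    by_cases hyU : y ∈ U
    · simp [hyU, hFK y hyU hy]
    · simp [hyU]
  have hl : ∫⁻ x, ‖fderiv ℝ (U.indicator F) x‖ₑ ∂μ = ∫⁻ x in U, ‖fderiv ℝ F x‖ₑ ∂μ := by
    rw [← lintegral_indicator hw.isOpen.measurableSet]
    congr 1 with x
    by_cases hx : x ∈ U
    · simp [hx, fderiv_indicator_of_mem hw.isOpen hx]
    · rw [hsupp x hx, indicator_of_notMem hx, ← ofReal_norm, norm_zero, ENNReal.ofReal_zero]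
  rw [hl]
  have hDint' : IntegrableOn (fderiv ℝ F) U μ :=
    (integrable_norm_iff ((hF.continuousOn_fderiv_of_isOpen hw.isOpen le_rfl).aestronglyMeasurable
      hw.isOpen.measurableSet)).1 hDint
  rw [← ofReal_integral_norm_eq_lintegral_enorm hDint', ← ofReal_measureReal hZfin,
    ← ENNReal.ofReal_mul (by positivity)]
  exact ENNReal.ofReal_le_ofReal hint

end IsQuasilinearSupersol

namespace IsQuasilinearSupersol

variable {E : Type*} [NormedAddCommGroup E] [NormedSpace ℝ E] [MeasurableSpace E] [BorelSpace E]
  {μ : Measure E} {q c C : ℝ} {U : Set E} {w : E → ℝ} {A : E → E}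

/-- De Giorgi's lemma: if `w` is rarely below some level near `x₀`, then `w x₀ > 0`. -/
theorem exists_pos_of_measure_sublevel_le [FiniteDimensional ℝ E] [μ.IsAddHaarMeasure]
    (hw : IsQuasilinearSupersol μ q c C U w A) (hq : 1 < q) (hc : 0 < c) (hC : 0 ≤ C)
    {x₀ : E} {s : ℝ} (hs : 0 < s) (hsU : closedBall x₀ s ⊆ U) :
    ∃ δ : ENNReal, 0 < δ ∧ ∀ k : ℝ, 0 < k → μ {x ∈ ball x₀ s | w x < k} ≤ δ → 0 < w x₀ := by
  set b : ContDiffBump x₀ := ⟨s / 2, s, half_pos hs, half_lt_self hs⟩ with hb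
  obtain ⟨C', hC', hest⟩ := hw.exists_lintegral_fderiv_truncation_le hq hc hC b hsU
  set d := Module.finrank ℝ E with hd
  set r : ℝ := (1 / 4) ^ (d + 1) with hr
  have hr0 : 0 < r := by positivity
  set ρ : ℝ := r / (32 * (C' + 1)) with hρ
  have hρ0 : 0 < ρ := by positivity
  have hρC : 32 * ρ * C' ≤ r := by
    rw [hρ]
    rw [show 32 * (r / (32 * (C' + 1))) * C' = r * (C' / (C' + 1)) by field_simp]
    exact mul_le_of_le_one_right hr0.le (div_le_one_of_le₀ (by linarith) (by linarith))
  refine ⟨μ (ball 0 ρ) / 2, ENNReal.div_pos (measure_ball_pos μ 0 hρ0).ne' (by simp), ?_⟩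
  intro k hk hsmall
  by_contra hx0
  have hx₀U : x₀ ∈ U := hsU (mem_closedBall_self hs.le)
  have hwx₀ : w x₀ = 0 := le_antisymm (not_lt.1 hx0) (hw.nonneg x₀ hx₀U)
  set τ : ℕ → ℝ := fun n => 1 / 2 - 1 / 2 ^ (n + 1) with hτ
  have hτ0 : ∀ n, 0 ≤ τ n := by
    intro n
    have : (1 : ℝ) / 2 ^ (n + 1) ≤ 1 / 2 := by
      rw [pow_succ]
      apply one_div_le_one_div_of_le two_pos
      have : (1 : ℝ) ≤ 2 ^ n := one_le_pow₀ one_le_two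
      linarith
    simp only [hτ]
    linarith
  set Z : ℝ → Set E := fun t => {x ∈ U | t < b x - w x / k} with hZ
  have hstep : ∀ n, μ (Z (τ n)) ≤ μ (ball 0 (ρ / 4 ^ n)) / 2 →
      μ (Z (τ (n + 1))) ≤ ENNReal.ofReal r * μ (Z (τ n)) := by
    intro n hn
    obtain ⟨hcd, hle⟩ := hest k (τ n) hk (hτ0 n)
    set f : E → ℝ := U.indicator fun x => max (b x - w x / k - τ n) 0 ^ 2 with hf
    have hfs : {x | f x ≠ 0} ⊆ Z (τ n) := by
      intro x hx
      by_contra hxZ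
      refine hx ?_
      by_cases hxU : x ∈ U
      · have : b x - w x / k - τ n ≤ 0 := by
          by_contra h
          exact hxZ ⟨hxU, by linarith⟩
        simp [hf, max_eq_right this]
      · simp [hf, hxU]
    have hFK := lintegral_enorm_le_of_measure_support_le (μ := μ) hcd
      (ρ := ρ / 4 ^ n) (by positivity) ((measure_mono hfs).trans hn)
    set e : ℝ := (1 / 4) ^ (n + 2) with he
    have he0 : 0 < e := by positivity
    have hgap : τ (n + 1) - τ n = (1 / 2) ^ (n + 2) := by
      simp only [hτ, one_div_pow, pow_succ]; field_simp; ring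
    have hcheb : ENNReal.ofReal e * μ (Z (τ (n + 1))) ≤ ∫⁻ x, ‖f x‖ₑ ∂μ := by
      refine le_trans ?_ (mul_meas_ge_le_lintegral (μ := μ) (f := fun x => ‖f x‖ₑ)
        hcd.continuous.measurable.enorm (ENNReal.ofReal e))
      gcongr
      intro x hx
      have h1 : (1 / 2 : ℝ) ^ (n + 2) ≤ b x - w x / k - τ n := by linarith [hx.2]
      have h2 : f x = max (b x - w x / k - τ n) 0 ^ 2 := by simp [hf, hx.1]
      show ENNReal.ofReal e ≤ ‖f x‖ₑ
      rw [← ofReal_norm]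
      apply ENNReal.ofReal_le_ofReal
      rw [h2, Real.norm_of_nonneg (sq_nonneg _), he,
        show (1 / 4 : ℝ) = (1 / 2) ^ 2 by norm_num, ← pow_mul, mul_comm, pow_mul]
      gcongr
      exact h1.trans (le_max_left _ _)
    have hall : ENNReal.ofReal e * μ (Z (τ (n + 1)))
        ≤ ENNReal.ofReal e * (ENNReal.ofReal r * μ (Z (τ n))) := by
      calc _ ≤ 2 * ENNReal.ofReal (ρ / 4 ^ n) * (ENNReal.ofReal C' * μ (Z (τ n))) :=
            hcheb.trans (hFK.trans (by gcongr))
        _ = ENNReal.ofReal (2 * (ρ / 4 ^ n) * C') * μ (Z (τ n)) := by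
            rw [ENNReal.ofReal_mul (by positivity), ENNReal.ofReal_mul two_pos.le,
              ENNReal.ofReal_ofNat, mul_assoc, mul_assoc, mul_assoc]
        _ ≤ ENNReal.ofReal (e * r) * μ (Z (τ n)) := by
            gcongr ENNReal.ofReal ?_ * _
            rw [he, show 2 * (ρ / 4 ^ n) * C' = (1 / 4) ^ (n + 2) * (32 * ρ * C') by
              simp only [one_div_pow, pow_succ]; field_simp; ring]
            gcongr
        _ = _ := by rw [ENNReal.ofReal_mul he0.le, mul_assoc]
    exact (ENNReal.mul_le_mul_iff_right (by simpa using he0) ENNReal.ofReal_ne_top).1 hall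
  have hballs : ∀ n : ℕ, ENNReal.ofReal r ^ n * μ (ball 0 ρ) ≤ μ (ball (0 : E) (ρ / 4 ^ n)) := by
    intro n
    rw [show ρ / 4 ^ n = (1 / 4) ^ n * ρ by
        simp only [one_div_pow]; field_simp,
      Measure.addHaar_ball_mul_of_pos μ (0 : E) (by positivity : (0 : ℝ) < (1 / 4) ^ n),
      ← ENNReal.ofReal_pow hr0.le]
    gcongr ENNReal.ofReal ?_ * _
    rw [hr, ← hd, ← pow_mul, ← pow_mul]
    exact pow_le_pow_of_le_one (by norm_num) (by norm_num) (by nlinarith)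
  have hdecay : ∀ n, μ (Z (τ n)) ≤ ENNReal.ofReal r ^ n * (μ (ball 0 ρ) / 2) := by
    intro n
    induction n with
    | zero =>
      simp only [pow_zero, one_mul]
      refine (measure_mono fun x hx => ?_).trans hsmall
      have hx2 : 0 < b x - w x / k := by
        have := hx.2
        simpa [hτ] using this
      have hwk : 0 ≤ w x / k := div_nonneg (hw.nonneg x hx.1) hk.le
      refine ⟨?_, ?_⟩
      · by_contra h
        have : b x = 0 := b.zero_of_le_dist (by simpa using h)
        linarith
      · have : w x / k < 1 := by linarith [b.le_one (x := x)]
        rwa [div_lt_one hk] at this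
    | succ n ih =>
      have hn : μ (Z (τ n)) ≤ μ (ball 0 (ρ / 4 ^ n)) / 2 := by
        refine ih.trans ?_
        rw [← mul_div_assoc]
        exact ENNReal.div_le_div_right (hballs n) 2
      calc _ ≤ ENNReal.ofReal r * μ (Z (τ n)) := hstep n hn
        _ ≤ ENNReal.ofReal r * (ENNReal.ofReal r ^ n * (μ (ball 0 ρ) / 2)) := by gcongr
        _ = _ := by rw [pow_succ]; ring
  have hr1 : ENNReal.ofReal r < 1 := by
    rw [ENNReal.ofReal_lt_one, hr]
    exact pow_lt_one₀ (by norm_num) (by norm_num) (by omega)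
  have hlim : Tendsto (fun n => ENNReal.ofReal r ^ n * (μ (ball 0 ρ) / 2)) atTop (𝓝 0) := by
    have := ENNReal.Tendsto.mul_const (ENNReal.tendsto_pow_atTop_nhds_zero_of_lt_one hr1)
      (b := μ (ball (0 : E) ρ) / 2)
      (Or.inr (ENNReal.div_ne_top measure_ball_lt_top.ne two_ne_zero))
    simpa using this
  have hZ0 : μ (Z (1 / 2)) = 0 := by
    refine le_antisymm (ge_of_tendsto' hlim fun n => le_trans (measure_mono ?_) (hdecay n)) bot_le
    intro x hx
    refine ⟨hx.1, lt_of_le_of_lt ?_ hx.2⟩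
    simp only [hτ]
    have : (0 : ℝ) < 1 / 2 ^ (n + 1) := by positivity
    linarith
  have hZopen : IsOpen (Z (1 / 2)) := by
    have hθ : ContinuousOn (fun x => b x - w x / k) U :=
      b.continuous.continuousOn.sub (hw.contDiffOn.continuousOn.div_const k)
    exact hθ.isOpen_inter_preimage hw.isOpen isOpen_Ioi
  have hmem : x₀ ∈ Z (1 / 2) := ⟨hx₀U, by
    rw [hwx₀, zero_div, b.one_of_mem_closedBall (by simp [b.rIn_pos.le])]; norm_num⟩
  exact (hZopen.measure_pos μ ⟨x₀, hmem⟩).ne' hZ0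

end IsQuasilinearSupersol

namespace IsQuasilinearSupersol

variable {E : Type*} [NormedAddCommGroup E] [NormedSpace ℝ E] [MeasurableSpace E] [BorelSpace E]
  {μ : Measure E} {q c C : ℝ} {U : Set E} {w : E → ℝ} {A : E → E}

/-- Logarithmic estimate, uniform in `ε`. -/
theorem exists_lintegral_fderiv_log_le [FiniteDimensional ℝ E] [IsFiniteMeasureOnCompacts μ]
    (hw : IsQuasilinearSupersol μ q c C U w A) (hq : 1 < q) (hc : 0 < c) (hC : 0 ≤ C)
    {x₀ : E} (b : ContDiffBump x₀) (hb : closedBall x₀ b.rOut ⊆ U) :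
    ∃ C' : ℝ, ∀ ε : ℝ, 0 < ε →
      ∫⁻ x in closedBall x₀ b.rIn, ‖fderiv ℝ (fun y => Real.log (w y + ε)) x‖ₑ ∂μ
        ≤ ENNReal.ofReal C' := by
  obtain ⟨Λ, hΛ⟩ := (b.contDiff (n := 1)).continuous_fderiv one_ne_zero
    |>.bounded_above_of_compact_support (b.hasCompactSupport.fderiv ℝ)
  have hΛ0 : 0 ≤ Λ := (norm_nonneg _).trans (hΛ x₀)
  obtain ⟨n, hn⟩ := exists_nat_ge q
  have hn1 : (1 : ℝ) < n := hq.trans_le hn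
  obtain ⟨m, rfl⟩ : ∃ m, n = m + 1 := ⟨n - 1, by
    have : 1 < n := by exact_mod_cast hn1
    omega⟩
  have hq1 : 0 < q - 1 := by linarith
  obtain ⟨C₁, hC₁, hyoung⟩ := exists_forall_mul_rpow_le hq
    (L := (m + 1) * Λ * C) (δ := (q - 1) * c / 2) (by positivity) (by positivity)
  set K := closedBall x₀ b.rOut with hKdef
  have hK : IsCompact K := isCompact_closedBall _ _
  set κ := 2 / ((q - 1) * c) with hκ
  have hκ0 : 0 < κ := by positivity
  refine ⟨(1 + κ * (C₁ + C)) * μ.real K, fun ε hε => ?_⟩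
  have hWpos : ∀ x ∈ U, 0 < w x + ε := fun x hx => by linarith [hw.nonneg x hx]
  have hW : ContDiffOn ℝ 1 (fun x => w x + ε) U := hw.contDiffOn.add contDiffOn_const
  have hlog : ContDiffOn ℝ 1 (fun x => Real.log (w x + ε)) U :=
    hW.log fun x hx => (hWpos x hx).ne'
  have hWd : ∀ x ∈ U, HasFDerivAt (fun x => w x + ε) (fderiv ℝ w x) x := fun x hx =>
    ((hw.contDiffOn.differentiableOn one_ne_zero).differentiableAt
        (hw.isOpen.mem_nhds hx)).hasFDerivAt.add_const ε
  have hlogd : ∀ x ∈ U, ‖fderiv ℝ (fun x => Real.log (w x + ε)) x‖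
      = ‖fderiv ℝ w x‖ / (w x + ε) := fun x hx => by
    rw [((hWd x hx).log (hWpos x hx).ne').fderiv, norm_smul, Real.norm_of_nonneg
      (inv_nonneg.2 (hWpos x hx).le), div_eq_inv_mul]
  set F : E → ℝ := fun x => b x ^ (m + 1) * (w x + ε) ^ (1 - q) with hFdef
  have hF : ContDiffOn ℝ 1 F U :=
    (b.contDiff.contDiffOn.pow (m + 1)).mul (hW.rpow_const_of_ne fun x hx => (hWpos x hx).ne')
  have hF0 : ∀ x ∈ U, 0 ≤ F x := fun x hx =>
    mul_nonneg (pow_nonneg b.nonneg _) (Real.rpow_nonneg (hWpos x hx).le _)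
  have hb0 : ∀ x, x ∉ K → b x = 0 := fun x hx => b.zero_of_le_dist (le_of_lt (by simpa [K] using hx))
  have hFK : ∀ x ∈ U, x ∉ K → F x = 0 := fun x _ hxK => by simp [F, hb0 x hxK]
  have hder : ∀ x ∈ U, fderiv ℝ F x = b x ^ (m + 1) •
      (((1 - q) * (w x + ε) ^ (1 - q - 1)) • fderiv ℝ w x)
      + (w x + ε) ^ (1 - q) • (((m + 1 : ℝ) * b x ^ m) • fderiv ℝ b x) := by
    intro x hx
    have hbd : HasFDerivAt b (fderiv ℝ b x) x :=
      (b.contDiff (n := 1)).differentiable one_ne_zero x |>.hasFDerivAt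
    have h1 := hbd.pow (m + 1)
    have h2 := h1.mul ((hWd x hx).rpow_const (p := 1 - q) (Or.inl (hWpos x hx).ne'))
    refine HasFDerivAt.fderiv (h2.congr_fderiv ?_)
    simp only [add_tsub_cancel_right, nsmul_eq_mul]
    push_cast
    rfl
  have hXint := hw.integrableOn_test hq hF hK hb hFK
  have hX0 := hw.weak F _ hF hF0 hK hb hFK
  set X : E → ℝ := fun x => fderiv ℝ F x (A x) + C * w x ^ (q - 1) * F x with hX
  have hXle : ∀ x ∈ U, κ * X x
      ≤ κ * (C₁ + C) - b x ^ (m + 1) * (‖fderiv ℝ w x‖ / (w x + ε)) ^ q := by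
    intro x hx
    set W := w x + ε with hWdef
    have hW0 : 0 < W := hWpos x hx
    set T := ‖fderiv ℝ w x‖ with hT
    have hT0 : 0 ≤ T := norm_nonneg _
    set t := T / W with ht
    have ht0 : 0 ≤ t := by positivity
    have hβ0 : 0 ≤ b x := b.nonneg
    have hβ1 : b x ≤ 1 := b.le_one
    have e1 : W ^ (1 - q) * T ^ (q - 1) = t ^ (q - 1) := by
      rw [ht, Real.div_rpow hT0 hW0.le, show 1 - q = -(q - 1) by ring, Real.rpow_neg hW0.le]
      field_simp
    have e2 : W ^ (1 - q - 1) * T ^ q = t ^ q := by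
      rw [ht, Real.div_rpow hT0 hW0.le, show 1 - q - 1 = -q by ring, Real.rpow_neg hW0.le]
      field_simp
    have e3 : w x ^ (q - 1) * W ^ (1 - q) ≤ 1 := by
      rw [show 1 - q = -(q - 1) by ring, Real.rpow_neg hW0.le, ← div_eq_mul_inv]
      refine div_le_one_of_le₀ ?_ (Real.rpow_nonneg hW0.le _)
      exact Real.rpow_le_rpow (hw.nonneg x hx) (by linarith) hq1.le
    have hp1 : fderiv ℝ b x (A x) ≤ Λ * (C * T ^ (q - 1)) :=
      (le_abs_self _).trans (((fderiv ℝ b x).le_opNorm _).trans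
        (mul_le_mul (hΛ x) (hw.growth x hx) (norm_nonneg _) hΛ0))
    have hp2 := hw.coercive x hx
    have hWq : 0 ≤ W ^ (1 - q) := Real.rpow_nonneg hW0.le _
    have hWq1 : 0 ≤ W ^ (1 - q - 1) := Real.rpow_nonneg hW0.le _
    have hbound : X x ≤ (m + 1) * Λ * C * (b x ^ m * t ^ (q - 1))
        - (q - 1) * c * (b x ^ (m + 1) * t ^ q) + C := by
      simp only [hX, hder x hx, _root_.add_apply, _root_.smul_apply, smul_eq_mul]
      have a1 : W ^ (1 - q) * ((m + 1) * b x ^ m * fderiv ℝ b x (A x))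
          ≤ (m + 1) * Λ * C * (b x ^ m * t ^ (q - 1)) := by
        calc _ ≤ W ^ (1 - q) * ((m + 1) * b x ^ m * (Λ * (C * T ^ (q - 1)))) := by gcongr
          _ = (m + 1) * Λ * C * (b x ^ m * (W ^ (1 - q) * T ^ (q - 1))) := by ring
          _ = _ := by rw [e1]
      have a2 : b x ^ (m + 1) * ((1 - q) * W ^ (1 - q - 1) * fderiv ℝ w x (A x))
          ≤ -((q - 1) * c * (b x ^ (m + 1) * t ^ q)) := by
        have : b x ^ (m + 1) * W ^ (1 - q - 1) * (q - 1) * (c * T ^ q)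
            ≤ b x ^ (m + 1) * W ^ (1 - q - 1) * (q - 1) * fderiv ℝ w x (A x) := by gcongr
        rw [← e2]
        linarith
      have a3 : C * w x ^ (q - 1) * F x ≤ C := by
        calc _ = C * (b x ^ (m + 1) * (w x ^ (q - 1) * W ^ (1 - q))) := by
              simp only [hFdef]; ring
          _ ≤ C * (1 * 1) := by
              gcongr
              · exact mul_nonneg (Real.rpow_nonneg (hw.nonneg x hx) _) hWq
              · exact pow_le_one₀ hβ0 hβ1
          _ = C := by ring
      linarith
    have hY : (m + 1) * Λ * C * (b x ^ m * t ^ (q - 1))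
        ≤ (q - 1) * c / 2 * (b x ^ (m + 1) * t ^ q) + C₁ := by
      have h := hyoung 1 (b x * t) zero_le_one (by positivity)
      rw [one_mul, Real.one_rpow, mul_one, Real.mul_rpow hβ0 ht0, Real.mul_rpow hβ0 ht0] at h
      have hmq : 0 ≤ (m + 1 : ℝ) - q := by push_cast at hn; linarith
      set γ := b x ^ ((m + 1 : ℝ) - q) with hγ
      have hγ0 : 0 ≤ γ := Real.rpow_nonneg hβ0 _
      have hγ1 : γ ≤ 1 := Real.rpow_le_one hβ0 hβ1 hmq
      have g1 : b x ^ m = γ * b x ^ (q - 1) := by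
        rw [hγ, ← Real.rpow_add_of_nonneg hβ0 hmq hq1.le, ← Real.rpow_natCast]
        congr 1; ring
      have g2 : b x ^ (m + 1) = γ * b x ^ q := by
        rw [hγ, ← Real.rpow_add_of_nonneg hβ0 hmq (by linarith), ← Real.rpow_natCast]
        congr 1; push_cast; ring
      rw [g1, g2]
      calc _ = γ * ((m + 1) * Λ * C * (b x ^ (q - 1) * t ^ (q - 1))) := by ring
        _ ≤ γ * ((q - 1) * c / 2 * (b x ^ q * t ^ q) + C₁) := by gcongr
        _ = (q - 1) * c / 2 * (γ * b x ^ q * t ^ q) + γ * C₁ := by ring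
        _ ≤ _ := by gcongr; exact mul_le_of_le_one_left hC₁ hγ1
    have : X x ≤ (C₁ + C) - (q - 1) * c / 2 * (b x ^ (m + 1) * t ^ q) := by linarith
    calc κ * X x ≤ κ * ((C₁ + C) - (q - 1) * c / 2 * (b x ^ (m + 1) * t ^ q)) := by gcongr
      _ = _ := by rw [hκ]; field_simp
  have hK'K : closedBall x₀ b.rIn ⊆ K := closedBall_subset_closedBall b.rIn_lt_rOut.le
  have hlogi : IntegrableOn (fderiv ℝ fun y => Real.log (w y + ε)) (closedBall x₀ b.rIn) μ :=
    ((hlog.continuousOn_fderiv_of_isOpen hw.isOpen le_rfl).mono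
      (hK'K.trans hb)).integrableOn_compact (isCompact_closedBall _ _)
  rw [← ofReal_integral_norm_eq_lintegral_enorm hlogi]
  apply ENNReal.ofReal_le_ofReal
  have hKm : MeasurableSet K := hK.isClosed.measurableSet
  have hi : IntegrableOn (K.indicator fun _ => 1 + κ * (C₁ + C)) U μ := by
    refine IntegrableOn.mono_set ?_ (subset_univ U)
    rw [integrableOn_univ, integrable_indicator_iff hKm]
    exact integrableOn_const hK.measure_lt_top.ne
  have hptw : ∀ x ∈ U, (closedBall x₀ b.rIn).indicator
      (fun x => ‖fderiv ℝ (fun y => Real.log (w y + ε)) x‖) x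
      ≤ K.indicator (fun _ => 1 + κ * (C₁ + C)) x - κ * X x := by
    intro x hx
    have h1 := hXle x hx
    by_cases hxK : x ∈ K
    · rw [indicator_of_mem hxK]
      set t := ‖fderiv ℝ w x‖ / (w x + ε) with ht
      have ht0 : 0 ≤ t := div_nonneg (norm_nonneg _) (hWpos x hx).le
      have hbt : 0 ≤ b x ^ (m + 1) * t ^ q :=
        mul_nonneg (pow_nonneg b.nonneg _) (Real.rpow_nonneg ht0 _)
      by_cases hxI : x ∈ closedBall x₀ b.rIn
      · rw [indicator_of_mem hxI, hlogd x hx, ← ht]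
        rw [b.one_of_mem_closedBall hxI, one_pow, one_mul] at h1
        have : t ≤ 1 + t ^ q := by
          rcases le_total t 1 with h | h
          · linarith [Real.rpow_nonneg ht0 q]
          · linarith [Real.self_le_rpow_of_one_le h hq.le]
        linarith
      · rw [indicator_of_notMem hxI]
        linarith
    · have hX0 : X x = 0 := by
        simp [X, fderiv_eq_zero_of_eq_zero_off hw.isOpen hK.isClosed hFK hx hxK, hFK x hx hxK]
      rw [indicator_of_notMem hxK, indicator_of_notMem fun h => hxK (hK'K h), hX0]
      simp
  calc _ = ∫ x in U, (closedBall x₀ b.rIn).indicator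
        (fun x => ‖fderiv ℝ (fun y => Real.log (w y + ε)) x‖) x ∂μ := by
        rw [setIntegral_indicator isClosed_closedBall.measurableSet,
          inter_eq_self_of_subset_right (hK'K.trans hb)]
    _ ≤ ∫ x in U, (K.indicator (fun _ => 1 + κ * (C₁ + C)) x - κ * X x) ∂μ := by
        refine setIntegral_mono_on ?_ (hi.sub (hXint.const_mul κ)) hw.isOpen.measurableSet hptw
        refine IntegrableOn.mono_set ?_ (subset_univ U)
        rw [integrableOn_univ, integrable_indicator_iff isClosed_closedBall.measurableSet]
        exact hlogi.norm
    _ = (1 + κ * (C₁ + C)) * μ.real K - κ * ∫ x in U, X x ∂μ := by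
        rw [integral_sub hi (hXint.const_mul κ), integral_const_mul,
          setIntegral_indicator hKm, inter_eq_self_of_subset_right hb]
        simp [mul_comm]
    _ ≤ _ := sub_le_self _ (mul_nonneg hκ0.le hX0)

end IsQuasilinearSupersol

namespace IsQuasilinearSupersol

variable {E : Type*} [NormedAddCommGroup E] [NormedSpace ℝ E] [MeasurableSpace E] [BorelSpace E]
  {μ : Measure E} {q c C : ℝ} {U : Set E} {w : E → ℝ} {A : E → E}

/-- Strong maximum principle: the zero set of a supersolution is open. -/
theorem eventually_eq_zero [FiniteDimensional ℝ E] [μ.IsAddHaarMeasure]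
    (hw : IsQuasilinearSupersol μ q c C U w A) (hq : 1 < q) (hc : 0 < c) (hC : 0 ≤ C)
    {x₀ : E} (hx₀ : x₀ ∈ U) (hwx₀ : w x₀ = 0) : ∀ᶠ x in 𝓝 x₀, w x = 0 := by
  obtain ⟨ε, hε, hεU⟩ := Metric.isOpen_iff.1 hw.isOpen x₀ hx₀
  set R := ε / 4 with hR
  have hR0 : 0 < R := by positivity
  have hRU : closedBall x₀ (3 * R) ⊆ U :=
    (closedBall_subset_ball (by linarith)).trans hεU
  let b : ContDiffBump x₀ := ⟨2 * R, 3 * R, by positivity, by linarith⟩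
  obtain ⟨C', hlog⟩ := hw.exists_lintegral_fderiv_log_le hq hc hC b hRU
  filter_upwards [ball_mem_nhds x₀ hR0] with x₁ hx₁
  by_contra hne
  have hx₁U : x₁ ∈ U := hRU (ball_subset_closedBall (ball_subset_ball (by linarith) hx₁))
  have hpos : 0 < w x₁ := (hw.nonneg x₁ hx₁U).lt_of_ne' hne
  set k₀ := w x₁ / 2 with hk₀
  have hk₀0 : 0 < k₀ := by positivity
  have hev : ∀ᶠ x in 𝓝 x₁, k₀ < w x :=
    (hw.contDiffOn.continuousOn.continuousAt (hw.isOpen.mem_nhds hx₁U)).eventually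
      (lt_mem_nhds (by linarith))
  obtain ⟨s', hs', hs'w⟩ := Metric.eventually_nhds_iff_ball.1 hev
  set s := min s' R with hs
  have hs0 : 0 < s := lt_min hs' hR0
  have hsR : s ≤ R := min_le_right _ _
  have hsw : ∀ x ∈ ball x₁ s, k₀ < w x := fun x hx =>
    hs'w x (ball_subset_ball (min_le_left _ _) hx)
  have hsU : closedBall x₀ s ⊆ U := (closedBall_subset_closedBall (by linarith)).trans hRU
  obtain ⟨δ, hδ, hgiorgi⟩ := hw.exists_pos_of_measure_sublevel_le hq hc hC hs0 hsU
  set h := x₀ - x₁ with hh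
  set D := ‖h‖ * C' with hD
  obtain ⟨L, hL0, hLδ⟩ : ∃ L : ℝ, 0 < L ∧ ENNReal.ofReal (D / L) < δ := by
    have h1 : Tendsto (fun L : ℝ => ENNReal.ofReal (D / L)) atTop (𝓝 0) := by
      have := ENNReal.tendsto_ofReal (tendsto_const_nhds.div_atTop tendsto_id (a := D)
        (l := (atTop : Filter ℝ)))
      simpa using this
    exact ((eventually_gt_atTop 0).and (h1.eventually (gt_mem_nhds hδ))).exists
  set k := k₀ / (2 * Real.exp L) with hk
  have hk0 : 0 < k := by positivity
  refine absurd hwx₀ (hgiorgi k hk0 (le_trans ?_ hLδ.le)).ne'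
  have hlogk : Real.log k₀ - Real.log (2 * k) = L := by
    rw [← Real.log_div hk₀0.ne' (by positivity), hk,
      show k₀ / (2 * (k₀ / (2 * Real.exp L))) = Real.exp L by field_simp, Real.log_exp]
  set f : E → ℝ := fun y => Real.log (w y + k) with hf
  have hfU : ContDiffOn ℝ 1 f U := (hw.contDiffOn.add contDiffOn_const).log fun x hx => by
    have := hw.nonneg x hx
    positivity
  have htrans := lintegral_enorm_translate_sub_le (μ := μ) hw.isOpen hfU
    (measurableSet_ball (x := x₁) (ε := s)) (measurableSet_closedBall (x := x₀) (ε := 2 * R))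
    ((closedBall_subset_closedBall (by linarith)).trans hRU) (h := h) (by
      intro x hx t ht
      rw [mem_closedBall, dist_eq_norm]
      rw [mem_ball, dist_eq_norm] at hx hx₁
      calc ‖x + t • h - x₀‖ = ‖(x - x₁) + (1 - t) • (x₁ - x₀)‖ := by
            congr 1; rw [hh]; module
        _ ≤ ‖x - x₁‖ + ‖(1 - t) • (x₁ - x₀)‖ := norm_add_le _ _
        _ = ‖x - x₁‖ + (1 - t) * ‖x₁ - x₀‖ := by
            rw [norm_smul, Real.norm_of_nonneg (by linarith [ht.2])]
        _ ≤ 2 * R := by nlinarith [ht.1, ht.2, norm_nonneg (x₁ - x₀)])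
  set Z := {x ∈ ball x₀ s | w x < k} with hZ
  have hZo : IsOpen Z := (hw.contDiffOn.continuousOn.mono
    (ball_subset_closedBall.trans hsU)).isOpen_inter_preimage isOpen_ball isOpen_Iio
  set Z' := (fun x => x + h) ⁻¹' Z with hZ'
  have hZ'm : MeasurableSet Z' := (hZo.preimage (by fun_prop)).measurableSet
  have hμ : μ Z' = μ Z := measure_preimage_add_right μ h Z
  have hZ'B : Z' ⊆ ball x₁ s := by
    intro x hx
    have := hx.1
    simp only [mem_ball, dist_eq_norm] at this ⊢
    rwa [hh, show x + (x₀ - x₁) - x₀ = x - x₁ by abel] at this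
  have hlow : ENNReal.ofReal L * μ Z ≤ ENNReal.ofReal D := by
    calc _ = ∫⁻ _ in Z', ENNReal.ofReal L ∂μ := by rw [setLIntegral_const, hμ]
      _ ≤ ∫⁻ x in Z', ‖f (x + h) - f x‖ₑ ∂μ := by
          refine setLIntegral_mono' hZ'm fun x hx => ?_
          rw [← ofReal_norm, Real.norm_eq_abs, abs_sub_comm]
          refine ENNReal.ofReal_le_ofReal (le_trans ?_ (le_abs_self _))
          have h1 : Real.log k₀ ≤ f x :=
            Real.log_le_log hk₀0 (by linarith [hsw x (hZ'B hx)])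
          have h2 : f (x + h) ≤ Real.log (2 * k) := by
            have h3 := hw.nonneg (x + h) (hsU (ball_subset_closedBall hx.1))
            exact Real.log_le_log (by positivity) (by linarith [hx.2])
          linarith
      _ ≤ ∫⁻ x in ball x₁ s, ‖f (x + h) - f x‖ₑ ∂μ := lintegral_mono_set hZ'B
      _ ≤ ‖h‖ₑ * ENNReal.ofReal C' := htrans.trans (by gcongr; exact hlog k hk0)
      _ = _ := by rw [hD, ENNReal.ofReal_mul (norm_nonneg _), ofReal_norm]
  rw [ENNReal.ofReal_div_of_pos hL0, ENNReal.le_div_iff_mul_le (Or.inl (by simpa using hL0))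
    (Or.inl ENNReal.ofReal_ne_top), mul_comm]
  exact hlow

end IsQuasilinearSupersol

/-- The flux `‖a‖ ^ (p - 2) a` of the `p`-Laplacian. -/
def pFlux {H : Type*} [NormedAddCommGroup H] [InnerProductSpace ℝ H] (p : ℝ) (a : H) : H :=
  ‖a‖ ^ (p - 2) • a

section PFlux

variable {H : Type*} [NormedAddCommGroup H] [InnerProductSpace ℝ H] {p : ℝ}

theorem rpow_sub_two_mul_self (hp : 1 < p) {t : ℝ} (ht : 0 ≤ t) : t ^ (p - 2) * t = t ^ (p - 1) := by
  rcases ht.eq_or_lt with rfl | ht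
  · rw [mul_zero, Real.zero_rpow (by linarith)]
  · rw [← Real.rpow_add_one ht.ne']; congr 1; ring

theorem rpow_sub_one_mul_self (hp : 1 < p) {t : ℝ} (ht : 0 ≤ t) : t ^ (p - 1) * t = t ^ p := by
  rcases ht.eq_or_lt with rfl | ht
  · rw [mul_zero, Real.zero_rpow (by linarith)]
  · rw [← Real.rpow_add_one ht.ne']; congr 1; ring

theorem norm_pFlux (hp : 1 < p) (a : H) : ‖pFlux p a‖ = ‖a‖ ^ (p - 1) := by
  rw [pFlux, norm_smul, Real.norm_of_nonneg (Real.rpow_nonneg (norm_nonneg a) _),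
    rpow_sub_two_mul_self hp (norm_nonneg a)]

theorem inner_pFlux_self (hp : 1 < p) (a : H) : ⟪pFlux p a, a⟫ = ‖a‖ ^ p := by
  rw [pFlux, real_inner_smul_left, real_inner_self_eq_norm_sq, pow_two, ← mul_assoc,
    rpow_sub_two_mul_self hp (norm_nonneg a), rpow_sub_one_mul_self hp (norm_nonneg a)]

theorem pFlux_smul {t : ℝ} (hp : 1 < p) (ht : 0 ≤ t) (a : H) :
    pFlux p (t • a) = t ^ (p - 1) • pFlux p a := by
  rw [pFlux, pFlux, norm_smul, Real.norm_of_nonneg ht, Real.mul_rpow ht (norm_nonneg a), smul_smul,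
    smul_smul, ← rpow_sub_two_mul_self hp ht]
  congr 1; ring

theorem continuous_pFlux (hp : 1 < p) : Continuous (pFlux p : H → H) := by
  rw [continuous_iff_continuousAt]
  intro a
  by_cases ha : a = 0
  · subst ha
    rw [ContinuousAt, show pFlux p (0 : H) = 0 by simp [pFlux], tendsto_zero_iff_norm_tendsto_zero]
    simp only [norm_pFlux hp]
    have : Continuous fun a : H => ‖a‖ ^ (p - 1) :=
      continuous_norm.rpow_const fun _ => Or.inr (by linarith)
    have h := this.tendsto 0
    rwa [norm_zero, Real.zero_rpow (by linarith)] at h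
  · exact (continuous_norm.continuousAt.rpow_const (Or.inl (norm_ne_zero_iff.2 ha))).smul
      continuousAt_id

theorem inner_pFlux_le (hp : 1 < p) (a b : H) :
    p * ⟪pFlux p b, a⟫ ≤ ‖a‖ ^ p + (p - 1) * ‖b‖ ^ p := by
  have h1 : ⟪pFlux p b, a⟫ ≤ ‖b‖ ^ (p - 1) * ‖a‖ := by
    rw [← norm_pFlux hp]; exact real_inner_le_norm _ _
  have hpq := Real.HolderConjugate.conjExponent hp
  have h2 := Real.young_inequality_of_nonneg (norm_nonneg a)
    (Real.rpow_nonneg (norm_nonneg b) (p - 1)) hpq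
  have hq : (p - 1) * p.conjExponent = p := by
    rw [Real.conjExponent]; field_simp [show p - 1 ≠ 0 by linarith]
  rw [← Real.rpow_mul (norm_nonneg b), hq] at h2
  have hp0 : 0 < p := by linarith
  have h3 : p * (‖b‖ ^ p / p.conjExponent) = (p - 1) * ‖b‖ ^ p := by
    rw [Real.conjExponent]; field_simp [show p - 1 ≠ 0 by linarith]
  calc p * ⟪pFlux p b, a⟫ ≤ p * (‖b‖ ^ (p - 1) * ‖a‖) := by gcongr
    _ ≤ p * (‖a‖ ^ p / p + ‖b‖ ^ p / p.conjExponent) := by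
        rw [mul_comm (‖b‖ ^ (p - 1))]; gcongr
    _ = _ := by rw [mul_add, h3, mul_div_cancel₀ _ hp0.ne']

theorem inner_pFlux_sub_sub (hp : 1 < p) (a b : H) :
    ⟪pFlux p a - pFlux p b, a - b⟫
      = (‖a‖ ^ (p - 1) - ‖b‖ ^ (p - 1)) * (‖a‖ - ‖b‖)
        + (‖a‖ ^ (p - 2) + ‖b‖ ^ (p - 2)) * (‖a‖ * ‖b‖ - ⟪a, b⟫) := by
  simp only [pFlux, inner_sub_left, inner_sub_right, real_inner_smul_left,
    real_inner_self_eq_norm_sq, real_inner_comm a b,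
    ← rpow_sub_two_mul_self hp (norm_nonneg a), ← rpow_sub_two_mul_self hp (norm_nonneg b)]
  ring

theorem rpow_sub_mul_sub_nonneg {r : ℝ} (hr : 0 < r) {x y : ℝ} (hx : 0 ≤ x) (hy : 0 ≤ y) :
    0 ≤ (x ^ r - y ^ r) * (x - y) := by
  rcases le_total x y with h | h
  · exact mul_nonneg_of_nonpos_of_nonpos (sub_nonpos.2 (Real.rpow_le_rpow hx h hr.le))
      (sub_nonpos.2 h)
  · exact mul_nonneg (sub_nonneg.2 (Real.rpow_le_rpow hy h hr.le)) (sub_nonneg.2 h)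

theorem inner_pFlux_sub_sub_nonneg (hp : 1 < p) (a b : H) :
    0 ≤ ⟪pFlux p a - pFlux p b, a - b⟫ := by
  rw [inner_pFlux_sub_sub hp]
  have h1 := rpow_sub_mul_sub_nonneg (r := p - 1) (by linarith) (norm_nonneg a) (norm_nonneg b)
  have h2 := sub_nonneg.2 (real_inner_le_norm a b)
  have h3 := Real.rpow_nonneg (norm_nonneg a) (p - 2)
  have h4 := Real.rpow_nonneg (norm_nonneg b) (p - 2)
  positivity

theorem eq_of_inner_pFlux_sub_sub_eq_zero (hp : 1 < p) {a b : H}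
    (h : ⟪pFlux p a - pFlux p b, a - b⟫ = 0) : a = b := by
  rw [inner_pFlux_sub_sub hp] at h
  have h1 := rpow_sub_mul_sub_nonneg (r := p - 1) (by linarith) (norm_nonneg a) (norm_nonneg b)
  have h2 := sub_nonneg.2 (real_inner_le_norm a b)
  have h3 := Real.rpow_nonneg (norm_nonneg a) (p - 2)
  have h4 := Real.rpow_nonneg (norm_nonneg b) (p - 2)
  have h5 := mul_nonneg (add_nonneg h3 h4) h2
  have h6 : (‖a‖ ^ (p - 1) - ‖b‖ ^ (p - 1)) * (‖a‖ - ‖b‖) = 0 := by linarith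
  have h7 : (‖a‖ ^ (p - 2) + ‖b‖ ^ (p - 2)) * (‖a‖ * ‖b‖ - ⟪a, b⟫) = 0 := by linarith
  have hab : ‖a‖ = ‖b‖ := by
    rcases mul_eq_zero.1 h6 with h | h
    · exact (Real.rpow_left_inj (norm_nonneg a) (norm_nonneg b) (by linarith)).1 (sub_eq_zero.1 h)
    · exact sub_eq_zero.1 h
  by_cases ha : a = 0
  · rw [ha, norm_zero] at hab
    rw [ha, norm_eq_zero.1 hab.symm]
  · have ha0 : 0 < ‖a‖ ^ (p - 2) := Real.rpow_pos_of_pos (norm_pos_iff.2 ha) _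
    have h8 : ‖a‖ * ‖b‖ - ⟪a, b⟫ = 0 := (mul_eq_zero.1 h7).resolve_left (by linarith)
    have h9 := inner_eq_norm_mul_iff_real.1 (sub_eq_zero.1 h8).symm
    rw [hab] at h9
    exact smul_right_injective H (hab ▸ norm_ne_zero_iff.2 ha) h9

theorem exists_eventually_abs_rpow_sub_le {t : ℝ} (ht : 0 < t) (r : ℝ) :
    ∃ L, 0 < L ∧ ∀ᶠ z : ℝ × ℝ in 𝓝 (t, t), |z.1 ^ r - z.2 ^ r| ≤ L * |z.1 - z.2| := by
  have h := (Real.hasStrictDerivAt_rpow_const_of_ne ht.ne' r).isLittleO.def one_pos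
  refine ⟨1 + |r * t ^ (r - 1)|, by positivity, h.mono fun z hz => ?_⟩
  simp only [ContinuousLinearMap.toSpanSingleton_apply, smul_eq_mul, Real.norm_eq_abs] at hz
  have h1 := abs_sub_abs_le_abs_sub (z.1 ^ r - z.2 ^ r) ((z.1 - z.2) * (r * t ^ (r - 1)))
  rw [abs_mul] at h1
  linarith

theorem exists_eventually_le_rpow_sub_mul_sub {t : ℝ} (ht : 0 < t) {r : ℝ} (hr : 0 < r) :
    ∃ c, 0 < c ∧ ∀ᶠ z : ℝ × ℝ in 𝓝 (t, t),
      c * (z.1 - z.2) ^ 2 ≤ (z.1 ^ r - z.2 ^ r) * (z.1 - z.2) := by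
  have hD : 0 < r * t ^ (r - 1) := by positivity
  have h := (Real.hasStrictDerivAt_rpow_const_of_ne ht.ne' r).isLittleO.def (half_pos hD)
  refine ⟨r * t ^ (r - 1) / 2, by positivity, h.mono fun z hz => ?_⟩
  simp only [ContinuousLinearMap.toSpanSingleton_apply, smul_eq_mul, Real.norm_eq_abs] at hz
  set D := r * t ^ (r - 1)
  have h1 := mul_le_mul_of_nonneg_right hz (abs_nonneg (z.1 - z.2))
  rw [← abs_mul, mul_assoc, abs_mul_abs_self] at h1
  have h2 := (abs_le.1 h1).1
  linarith

/-- Near a nonzero vector the flux is Lipschitz and strongly monotone. -/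
theorem exists_eventually_pFlux_sub_bounds (hp : 1 < p) {ξ : H} (hξ : ξ ≠ 0) :
    ∃ c C : ℝ, 0 < c ∧ 0 < C ∧ ∀ᶠ z : H × H in 𝓝 (ξ, ξ),
      c * ‖z.1 - z.2‖ ^ 2 ≤ ⟪pFlux p z.1 - pFlux p z.2, z.1 - z.2⟫ ∧
      ‖pFlux p z.1 - pFlux p z.2‖ ≤ C * ‖z.1 - z.2‖ := by
  have hn : 0 < ‖ξ‖ := norm_pos_iff.2 hξ
  have htend : Tendsto (fun z : H × H => (‖z.1‖, ‖z.2‖)) (𝓝 (ξ, ξ)) (𝓝 (‖ξ‖, ‖ξ‖)) :=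
    Continuous.tendsto (by fun_prop) (ξ, ξ)
  obtain ⟨L, hL, h1⟩ := exists_eventually_abs_rpow_sub_le hn (p - 2)
  obtain ⟨c, hc, h2⟩ := exists_eventually_le_rpow_sub_mul_sub hn (r := p - 1) (by linarith)
  set κ := ‖ξ‖ ^ (p - 2) with hκ
  have hκ0 : 0 < κ := Real.rpow_pos_of_pos hn _
  have hc1 : ContinuousAt (fun t : ℝ => t ^ (p - 2)) ‖ξ‖ :=
    continuousAt_id.rpow_const (Or.inl hn.ne')
  have h3 : ∀ᶠ t : ℝ in 𝓝 ‖ξ‖, κ / 2 < t ^ (p - 2) ∧ t ^ (p - 2) < 2 * κ ∧ t < 2 * ‖ξ‖ :=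
    (hc1.eventually (lt_mem_nhds (by simpa [hκ] using half_lt_self hκ0))).and
      ((hc1.eventually (gt_mem_nhds (by simp only [← hκ]; linarith))).and
        (gt_mem_nhds (by linarith)))
  refine ⟨min c (κ / 2), 2 * κ + L * (2 * ‖ξ‖), by positivity, by positivity, ?_⟩
  have htd := htend
  rw [nhds_prod_eq (x := ‖ξ‖)] at htd
  filter_upwards [htend.eventually h1, htend.eventually h2,
    htd.fst.eventually h3, htd.snd.eventually h3] with z g1 g2 g3 g4
  constructor
  · rw [inner_pFlux_sub_sub hp, norm_sub_sq_real]
    have h5 := sub_nonneg.2 (real_inner_le_norm z.1 z.2)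
    have e1 := min_le_left c (κ / 2)
    have e2 := min_le_right c (κ / 2)
    calc _ = min c (κ / 2) * (‖z.1‖ - ‖z.2‖) ^ 2
          + 2 * min c (κ / 2) * (‖z.1‖ * ‖z.2‖ - ⟪z.1, z.2⟫) := by ring
      _ ≤ c * (‖z.1‖ - ‖z.2‖) ^ 2 + 2 * (κ / 2) * (‖z.1‖ * ‖z.2‖ - ⟪z.1, z.2⟫) := by gcongr
      _ ≤ _ := by
        gcongr
        linarith [g3.1, g4.1]
  · calc _ = ‖‖z.1‖ ^ (p - 2) • (z.1 - z.2) + (‖z.1‖ ^ (p - 2) - ‖z.2‖ ^ (p - 2)) • z.2‖ := by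
          congr 1; simp only [pFlux]; module
      _ ≤ ‖z.1‖ ^ (p - 2) * ‖z.1 - z.2‖ + |‖z.1‖ ^ (p - 2) - ‖z.2‖ ^ (p - 2)| * ‖z.2‖ := by
          refine (norm_add_le _ _).trans (le_of_eq ?_)
          rw [norm_smul, norm_smul, Real.norm_of_nonneg (Real.rpow_nonneg (norm_nonneg _) _),
            Real.norm_eq_abs]
      _ ≤ 2 * κ * ‖z.1 - z.2‖ + (L * ‖z.1 - z.2‖) * (2 * ‖ξ‖) := by
          gcongr
          · exact g3.2.1.le
          · exact g1.trans (by gcongr; exact abs_norm_sub_norm_le _ _)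
          · exact g4.2.2.le
      _ = _ := by ring

end PFlux

theorem continuousOn_gradient {H : Type*} [NormedAddCommGroup H] [InnerProductSpace ℝ H]
    [CompleteSpace H] {w : H → ℝ} {Ω : Set H} (hΩ : IsOpen Ω) (hw : ContDiffOn ℝ 1 w Ω) :
    ContinuousOn (gradient w) Ω :=
  (InnerProductSpace.toDual ℝ H).symm.continuous.comp_continuousOn
    (hw.continuousOn_fderiv_of_isOpen hΩ le_rfl)

theorem norm_gradient {H : Type*} [NormedAddCommGroup H] [InnerProductSpace ℝ H]
    [CompleteSpace H] (w : H → ℝ) (x : H) : ‖gradient w x‖ = ‖fderiv ℝ w x‖ :=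
  (InnerProductSpace.toDual ℝ H).symm.norm_map _

theorem integrableOn_mul_of_eq_zero_off {E : Type*} [NormedAddCommGroup E]
    [NormedSpace ℝ E] [MeasurableSpace E] [BorelSpace E] {μ : Measure E}
    [IsFiniteMeasureOnCompacts μ] {B F : E → ℝ} {U K : Set E} {M : ℝ} (hU : IsOpen U)
    (hK : IsCompact K) (hKU : K ⊆ U) (hB : AEStronglyMeasurable B (μ.restrict U))
    (hBM : ∀ x ∈ K, |B x| ≤ M) (hF : ContinuousOn F U) (hFK : ∀ x ∈ U, x ∉ K → F x = 0) :
    IntegrableOn (fun x => B x * F x) U μ := by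
  refine IntegrableOn.of_forall_sdiff_eq_zero (s := K) ?_ hU.measurableSet
    fun x hx => by simp [hFK x hx.1 hx.2]
  refine ((hF.mono hKU).integrableOn_compact hK).bdd_mul (c := M)
    (hB.mono_measure (Measure.restrict_mono hKU le_rfl)) ?_
  filter_upwards [ae_restrict_mem hK.measurableSet] with x hx
  exact hBM x hx

section WeakForm

variable {d : ℕ} {p M : ℝ} {V w : EuclideanSpace ℝ (Fin d) → ℝ}
  {Ω U : Set (EuclideanSpace ℝ (Fin d))}

theorem aestronglyMeasurable_potential_mul (hp : 1 < p) (hU : IsOpen U) (hV : Measurable V)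
    (hw : ContinuousOn w U) :
    AEStronglyMeasurable (fun x => V x * w x ^ (p - 1)) (volume.restrict U) :=
  hV.aestronglyMeasurable.mul ((hw.rpow_const fun _ _ => Or.inr (by linarith)).aestronglyMeasurable
    hU.measurableSet)

theorem exists_abs_potential_mul_le (hp : 1 < p) (hM : ∀ x ∈ U, |V x| ≤ M)
    (hw : ContinuousOn w U) {K : Set (EuclideanSpace ℝ (Fin d))} (hKU : K ⊆ U)
    (hK : IsCompact K) : ∃ M', ∀ x ∈ K, |V x * w x ^ (p - 1)| ≤ M' := by
  obtain ⟨N, hN⟩ := hK.exists_bound_of_continuousOn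
    ((hw.mono hKU).rpow_const (p := p - 1) fun _ _ => Or.inr (by linarith))
  refine ⟨M * N, fun x hx => ?_⟩
  rw [abs_mul]
  exact mul_le_mul (hM x (hKU hx)) (hN x hx) (abs_nonneg _) ((abs_nonneg _).trans (hM x (hKU hx)))

theorem weakForm_integrand_eq (hp : 1 < p) (φ : EuclideanSpace ℝ (Fin d) → ℝ)
    (x : EuclideanSpace ℝ (Fin d)) (hwx : 0 ≤ w x) :
    ‖gradient w x‖ ^ (p - 2) * ⟪gradient w x, gradient φ x⟫ + V x * |w x| ^ (p - 2) * w x * φ x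
      = fderiv ℝ φ x (pFlux p (gradient w x)) + V x * w x ^ (p - 1) * φ x := by
  rw [inner_gradient_right, pFlux, map_smul, abs_of_nonneg hwx, mul_assoc (V x),
    rpow_sub_two_mul_self hp hwx]
  rfl

theorem IsWeakSupersol.integral_nonneg (h : IsWeakSupersol p V Ω w) (hp : 1 < p) (hΩ : IsOpen Ω)
    (hV : Measurable V) (hM : ∀ x ∈ Ω, |V x| ≤ M) (hw : ContDiffOn ℝ 1 w Ω)
    (hw0 : ∀ x ∈ Ω, 0 ≤ w x) (hU : IsOpen U) (hUΩ : U ⊆ Ω) {F : EuclideanSpace ℝ (Fin d) → ℝ}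
    (hF : ContDiffOn ℝ 1 F U) (hF0 : ∀ x ∈ U, 0 ≤ F x) {K : Set (EuclideanSpace ℝ (Fin d))}
    (hK : IsCompact K) (hKU : K ⊆ U) (hFK : ∀ x ∈ U, x ∉ K → F x = 0) :
    0 ≤ ∫ x in U, (fderiv ℝ F x (pFlux p (gradient w x)) + V x * w x ^ (p - 1) * F x) := by
  refine integral_nonneg_of_forall_smooth_test hΩ hU hUΩ
    ((continuous_pFlux hp).comp_continuousOn (continuousOn_gradient hΩ hw))
    (aestronglyMeasurable_potential_mul hp hΩ hV hw.continuousOn)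
    (fun K hKΩ hK => exists_abs_potential_mul_le hp hM hw.continuousOn hKΩ hK)
    (fun φ hφ hc hs hφ0 => ?_) hF hF0 hK hKU hFK
  refine (h φ hφ hc hs hφ0).trans_eq (setIntegral_congr_fun hΩ.measurableSet fun x hx => ?_)
  exact weakForm_integrand_eq hp φ x (hw0 x hx)

theorem IsWeakSubsol.integral_nonpos (h : IsWeakSubsol p V Ω w) (hp : 1 < p) (hΩ : IsOpen Ω)
    (hV : Measurable V) (hM : ∀ x ∈ Ω, |V x| ≤ M) (hw : ContDiffOn ℝ 1 w Ω)
    (hw0 : ∀ x ∈ Ω, 0 ≤ w x) (hU : IsOpen U) (hUΩ : U ⊆ Ω) {F : EuclideanSpace ℝ (Fin d) → ℝ}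
    (hF : ContDiffOn ℝ 1 F U) (hF0 : ∀ x ∈ U, 0 ≤ F x) {K : Set (EuclideanSpace ℝ (Fin d))}
    (hK : IsCompact K) (hKU : K ⊆ U) (hFK : ∀ x ∈ U, x ∉ K → F x = 0) :
    ∫ x in U, (fderiv ℝ F x (pFlux p (gradient w x)) + V x * w x ^ (p - 1) * F x) ≤ 0 := by
  have key := integral_nonneg_of_forall_smooth_test (μ := volume) hΩ hU hUΩ
    (G := fun x => -pFlux p (gradient w x)) (B := fun x => -(V x * w x ^ (p - 1)))
    ((continuous_pFlux hp).comp_continuousOn (continuousOn_gradient hΩ hw)).neg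
    (aestronglyMeasurable_potential_mul hp hΩ hV hw.continuousOn).neg
    (fun K hKΩ hK => by
      simpa only [abs_neg] using exists_abs_potential_mul_le hp hM hw.continuousOn hKΩ hK)
    (fun φ hφ hc hs hφ0 => ?_) hF hF0 hK hKU hFK
  · rw [← neg_nonneg, ← integral_neg]
    refine key.trans_eq (integral_congr_ae (Eventually.of_forall fun x => ?_))
    simp only [map_neg]; ring
  · rw [← neg_nonpos, ← integral_neg]
    refine le_of_eq_of_le (setIntegral_congr_fun hΩ.measurableSet fun x hx => ?_) (h φ hφ hc hs hφ0)
    rw [weakForm_integrand_eq hp φ x (hw0 x hx)]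
    simp only [map_neg]; ring

theorem integrableOn_weakForm (hp : 1 < p) (hU : IsOpen U) (hV : Measurable V)
    (hM : ∀ x ∈ U, |V x| ≤ M) (hw : ContDiffOn ℝ 1 w U) {F : EuclideanSpace ℝ (Fin d) → ℝ}
    (hF : ContDiffOn ℝ 1 F U) {K : Set (EuclideanSpace ℝ (Fin d))}
    (hK : IsCompact K) (hKU : K ⊆ U) (hFK : ∀ x ∈ U, x ∉ K → F x = 0) :
    IntegrableOn
      (fun x => fderiv ℝ F x (pFlux p (gradient w x)) + V x * w x ^ (p - 1) * F x) U := by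
  obtain ⟨M', hM'⟩ := exists_abs_potential_mul_le hp hM hw.continuousOn hKU hK
  refine Integrable.add ?_ (integrableOn_mul_of_eq_zero_off hU hK hKU
    (aestronglyMeasurable_potential_mul hp hU hV hw.continuousOn) hM' hF.continuousOn hFK)
  refine integrableOn_of_continuousOn_of_eq_zero_off hU hK hKU
    ((hF.continuousOn_fderiv_of_isOpen hU le_rfl).clm_apply
      ((continuous_pFlux hp).comp_continuousOn (continuousOn_gradient hU hw))) fun x hx hxK => ?_
  simp [fderiv_eq_zero_of_eq_zero_off hU hK.isClosed hFK hx hxK]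

theorem IsWeakSupersol.isQuasilinearSupersol (h : IsWeakSupersol p V Ω w) (hp : 1 < p)
    (hΩ : IsOpen Ω) (hV : Measurable V) (hM : ∀ x ∈ Ω, |V x| ≤ M) (hw : ContDiffOn ℝ 1 w Ω)
    (hw0 : ∀ x ∈ Ω, 0 ≤ w x) :
    IsQuasilinearSupersol volume p 1 (max M 1) Ω w fun x => pFlux p (gradient w x) where
  isOpen := hΩ
  contDiffOn := hw
  nonneg := hw0
  continuousOn_flux := (continuous_pFlux hp).comp_continuousOn (continuousOn_gradient hΩ hw)
  coercive x _ := by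
    rw [← inner_gradient_left, real_inner_comm, inner_pFlux_self hp, norm_gradient, one_mul]
  growth x _ := by
    rw [norm_pFlux hp, norm_gradient]
    exact le_mul_of_one_le_left (Real.rpow_nonneg (norm_nonneg _) _) (le_max_right _ _)
  weak F K hF hF0 hK hKU hFK := by
    refine (h.integral_nonneg hp hΩ hV hM hw hw0 hΩ subset_rfl hF hF0 hK hKU hFK).trans ?_
    refine setIntegral_mono_on (integrableOn_weakForm hp hΩ hV hM hw hF hK hKU hFK) ?_
      hΩ.measurableSet fun x hx => ?_
    · refine integrableOn_of_continuousOn_of_eq_zero_off hΩ hK hKU ?_ fun x hx hxK => ?_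
      · have h1 := hF.continuousOn_fderiv_of_isOpen hΩ le_rfl
        have h2 : ContinuousOn (fun x => w x ^ (p - 1)) Ω :=
          hw.continuousOn.rpow_const fun x _ => Or.inr (by linarith)
        exact (h1.clm_apply ((continuous_pFlux hp).comp_continuousOn
          (continuousOn_gradient hΩ hw))).add ((continuousOn_const.mul h2).mul hF.continuousOn)
      · simp [fderiv_eq_zero_of_eq_zero_off hΩ hK.isClosed hFK hx hxK, hFK x hx hxK]
    · have h1 := Real.rpow_nonneg (hw0 x hx) (p - 1)
      have h2 := hF0 x hx
      have h3 : V x ≤ max M 1 := (le_abs_self _).trans ((hM x hx).trans (le_max_left _ _))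
      gcongr

end WeakForm

theorem not_isOpen_of_isCompact_of_nonempty {H : Type*} [NormedAddCommGroup H] [NormedSpace ℝ H]
    [Nontrivial H] {K : Set H} (hK : IsCompact K) (hne : K.Nonempty) : ¬ IsOpen K := by
  intro ho
  have := NormedSpace.noncompactSpace ℝ H
  exact noncompact_univ H ((IsClopen.eq_univ ⟨hK.isClosed, ho⟩ hne) ▸ hK)

theorem gradient_fun_sub {H : Type*} [NormedAddCommGroup H] [InnerProductSpace ℝ H]
    [CompleteSpace H] {f g : H → ℝ} {x : H} (hf : DifferentiableAt ℝ f x)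
    (hg : DifferentiableAt ℝ g x) :
    gradient (fun y => f y - g y) x = gradient f x - gradient g x := by
  rw [gradient, fderiv_fun_sub hf hg, map_sub]
  rfl

theorem isCompact_of_closure_inter_frontier_eq_empty {X : Type*} [PseudoMetricSpace X]
    [ProperSpace X] {Ω S : Set X} (hΩ : IsOpen Ω) (hb : Bornology.IsBounded Ω) (hSΩ : S ⊆ Ω)
    (hfar : closure S ∩ frontier Ω = ∅) (hS : ∀ x ∈ Ω, x ∈ closure S → x ∈ S) : IsCompact S := by
  refine isCompact_of_isClosed_isBounded (isClosed_of_closure_subset fun x hx => hS x ?_ hx)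
    (hb.subset hSΩ)
  by_contra hxΩ
  have : x ∈ closure S ∩ frontier Ω := ⟨hx, by
    rw [hΩ.frontier_eq]; exact ⟨closure_mono hSΩ hx, hxΩ⟩⟩
  rw [hfar] at this
  exact this

section Comparison

variable {d : ℕ} {p M : ℝ} {V u v : EuclideanSpace ℝ (Fin d) → ℝ}
  {Ω : Set (EuclideanSpace ℝ (Fin d))}

theorem IsWeakSupersol.pos_of_pos_on_frontier (h : IsWeakSupersol p V Ω v) (hd : 1 ≤ d)
    (hp : 1 < p) (hΩ : IsOpen Ω) (hΩb : Bornology.IsBounded Ω) (hV : Measurable V)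
    (hM : ∀ x ∈ Ω, |V x| ≤ M) (hv : ContDiffOn ℝ 1 v Ω) (hvc : ContinuousOn v (closure Ω))
    (hv0 : ∀ x ∈ closure Ω, 0 ≤ v x) (hvf : ∀ x ∈ frontier Ω, 0 < v x) : ∀ x ∈ Ω, 0 < v x := by
  have : Nonempty (Fin d) := ⟨⟨0, hd⟩⟩
  by_contra! hcon
  obtain ⟨x₀, hx₀, hvx₀⟩ := hcon
  have hv0' : ∀ x ∈ Ω, 0 ≤ v x := fun x hx => hv0 x (subset_closure hx)
  have hclosed : IsClosed (closure Ω ∩ v ⁻¹' {0}) :=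
    hvc.preimage_isClosed_of_isClosed isClosed_closure isClosed_singleton
  have hZ : closure Ω ∩ v ⁻¹' {0} = {x ∈ Ω | v x = 0} := by
    ext x
    refine ⟨fun hx => ⟨?_, hx.2⟩, fun hx => ⟨subset_closure hx.1, hx.2⟩⟩
    by_contra hxΩ
    refine (hvf x ?_).ne' hx.2
    rw [hΩ.frontier_eq]
    exact ⟨hx.1, hxΩ⟩
  have hcomp : IsCompact {x ∈ Ω | v x = 0} :=
    isCompact_of_isClosed_isBounded (hZ ▸ hclosed) (hΩb.subset fun x hx => hx.1)
  refine not_isOpen_of_isCompact_of_nonempty hcomp ⟨x₀, hx₀, le_antisymm hvx₀ (hv0' x₀ hx₀)⟩ ?_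
  refine isOpen_iff_mem_nhds.2 fun x hx => ?_
  have := (h.isQuasilinearSupersol hp hΩ hV hM hv hv0').eventually_eq_zero hp one_pos
    (zero_le_one.trans (le_max_right _ _)) hx.1 hx.2
  filter_upwards [this, hΩ.mem_nhds hx.1] with y hy hyΩ using ⟨hyΩ, hy⟩

theorem gradient_eq_of_touching (hΩ : IsOpen Ω) (hv : ContDiffOn ℝ 1 v Ω)
    (hu : ContDiffOn ℝ 1 u Ω) (hle : ∀ x ∈ Ω, u x ≤ v x) {x : EuclideanSpace ℝ (Fin d)}
    (hx : x ∈ Ω) (huv : u x = v x) : gradient u x = gradient v x := by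
  have hmin : IsLocalMin (fun y => v y - u y) x := by
    filter_upwards [hΩ.mem_nhds hx] with y hy
    simpa [huv] using hle y hy
  have h := gradient_fun_sub
    ((hv.differentiableOn one_ne_zero).differentiableAt (hΩ.mem_nhds hx))
    ((hu.differentiableOn one_ne_zero).differentiableAt (hΩ.mem_nhds hx))
  rw [gradient, hmin.fderiv_eq_zero, map_zero] at h
  exact (sub_eq_zero.1 h.symm).symm

/-- Strong comparison principle near a touching point which is not critical. -/
theorem IsWeakSupersol.eventually_eq_of_touching (h : IsWeakSupersol p V Ω v)
    (h' : IsWeakSubsol p V Ω u) (hp : 1 < p) (hΩ : IsOpen Ω) (hV : Measurable V)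
    (hM : ∀ x ∈ Ω, |V x| ≤ M) (hv : ContDiffOn ℝ 1 v Ω) (hu : ContDiffOn ℝ 1 u Ω)
    (hu0 : ∀ x ∈ Ω, 0 ≤ u x) (hle : ∀ x ∈ Ω, u x ≤ v x)
    {x₀ : EuclideanSpace ℝ (Fin d)} (hx₀ : x₀ ∈ Ω) (huv : u x₀ = v x₀) (hpos : 0 < v x₀)
    (hgrad : gradient v x₀ ≠ 0) : ∀ᶠ x in 𝓝 x₀, u x = v x := by
  have hv0 : ∀ x ∈ Ω, 0 ≤ v x := fun x hx => (hu0 x hx).trans (hle x hx)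
  have hgu := gradient_eq_of_touching hΩ hv hu hle hx₀ huv
  obtain ⟨c, C, hc, hC, hflux⟩ := exists_eventually_pFlux_sub_bounds hp hgrad
  obtain ⟨L, hL, hrpow⟩ := exists_eventually_abs_rpow_sub_le hpos (p - 1)
  have hnhds := hΩ.mem_nhds hx₀
  have t1 : Tendsto (fun x => (gradient v x, gradient u x)) (𝓝 x₀)
      (𝓝 (gradient v x₀, gradient v x₀)) := by
    have h1 := ((continuousOn_gradient hΩ hv).continuousAt hnhds).tendsto
    have h2 := ((continuousOn_gradient hΩ hu).continuousAt hnhds).tendsto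
    rw [hgu] at h2
    exact h1.prodMk_nhds h2
  have t2 : Tendsto (fun x => (v x, u x)) (𝓝 x₀) (𝓝 (v x₀, v x₀)) := by
    have h1 := (hv.continuousOn.continuousAt hnhds).tendsto
    have h2 := (hu.continuousOn.continuousAt hnhds).tendsto
    rw [huv] at h2
    exact h1.prodMk_nhds h2
  obtain ⟨r, hr, hball⟩ := Metric.eventually_nhds_iff_ball.1
    ((hΩ.eventually_mem hx₀).and ((t1.eventually hflux).and (t2.eventually hrpow)))
  set U := ball x₀ r with hU
  have hUo : IsOpen U := isOpen_ball
  have hUΩ : U ⊆ Ω := fun x hx => (hball x hx).1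
  have hvU := hv.mono hUΩ
  have huU := hu.mono hUΩ
  have hgrad_sub : ∀ x ∈ U, gradient (fun y => v y - u y) x = gradient v x - gradient u x :=
    fun x hx => gradient_fun_sub
      ((hv.differentiableOn one_ne_zero).differentiableAt (hΩ.mem_nhds (hUΩ hx)))
      ((hu.differentiableOn one_ne_zero).differentiableAt (hΩ.mem_nhds (hUΩ hx)))
  have hA : ContinuousOn (fun x => pFlux p (gradient v x) - pFlux p (gradient u x)) U :=
    ((continuous_pFlux hp).comp_continuousOn (continuousOn_gradient hUo hvU)).sub
      ((continuous_pFlux hp).comp_continuousOn (continuousOn_gradient hUo huU))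
  set C' := max C (|M| * L) with hC'
  have hC'0 : 0 ≤ C' := hC.le.trans (le_max_left _ _)
  have key : IsQuasilinearSupersol volume 2 c C' U (fun x => v x - u x)
      (fun x => pFlux p (gradient v x) - pFlux p (gradient u x)) :=
    { isOpen := hUo
      contDiffOn := hvU.sub huU
      nonneg := fun x hx => sub_nonneg.2 (hle x (hUΩ hx))
      continuousOn_flux := hA
      coercive := fun x hx => by
        rw [← norm_gradient, ← inner_gradient_left, hgrad_sub x hx, Real.rpow_two,
          real_inner_comm]
        exact (hball x hx).2.1.1
      growth := fun x hx => by
        rw [← norm_gradient, hgrad_sub x hx, show (2 : ℝ) - 1 = 1 by norm_num, Real.rpow_one]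
        exact (hball x hx).2.1.2.trans (by gcongr; exact le_max_left _ _)
      weak := fun F K hF hF0 hK hKU hFK => by
        have h1 := h.integral_nonneg hp hΩ hV hM hv hv0 hUo hUΩ hF hF0 hK hKU hFK
        have h2 := h'.integral_nonpos hp hΩ hV hM hu hu0 hUo hUΩ hF hF0 hK hKU hFK
        have hMU : ∀ x ∈ U, |V x| ≤ M := fun x hx => hM x (hUΩ hx)
        have i1 := integrableOn_weakForm hp hUo hV hMU hvU hF hK hKU hFK
        have i2 := integrableOn_weakForm hp hUo hV hMU huU hF hK hKU hFK
        have h3 := h2.trans h1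
        rw [← sub_nonneg, ← integral_sub i1 i2] at h3
        refine h3.trans (setIntegral_mono_on (i1.sub i2) ?_ hUo.measurableSet fun x hx => ?_)
        · refine integrableOn_of_continuousOn_of_eq_zero_off hUo hK hKU ?_ fun x hx hxK => ?_
          · have h5 : ContinuousOn (fun x => (v x - u x) ^ ((2 : ℝ) - 1)) U :=
              (hvU.continuousOn.sub huU.continuousOn).rpow_const fun x _ =>
                Or.inr (by norm_num)
            exact ((hF.continuousOn_fderiv_of_isOpen hUo le_rfl).clm_apply hA).add
              ((continuousOn_const.mul h5).mul hF.continuousOn)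
          · simp [fderiv_eq_zero_of_eq_zero_off hUo hK.isClosed hFK hx hxK, hFK x hx hxK]
        · have h6 : V x * (v x ^ (p - 1) - u x ^ (p - 1)) ≤ C' * (v x - u x) := by
            have h7 := (hball x hx).2.2
            have h8 : 0 ≤ v x - u x := sub_nonneg.2 (hle x (hUΩ hx))
            simp only [abs_of_nonneg h8] at h7
            calc _ ≤ |V x| * |v x ^ (p - 1) - u x ^ (p - 1)| := by
                  rw [← abs_mul]; exact le_abs_self _
              _ ≤ |M| * (L * (v x - u x)) := 
                  mul_le_mul ((hMU x hx).trans (le_abs_self _)) h7 (abs_nonneg _) (abs_nonneg _)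
              _ = |M| * L * (v x - u x) := by ring
              _ ≤ _ := by gcongr; exact le_max_right _ _
          have h9 := mul_le_mul_of_nonneg_right h6 (hF0 x hx)
          rw [show (2 : ℝ) - 1 = 1 by norm_num, Real.rpow_one, map_sub]
          linarith }
  have := key.eventually_eq_zero one_lt_two hc hC'0 (mem_ball_self hr) (by simp [huv])
  filter_upwards [this] with x hx
  linarith

end Comparison

theorem mul_inner_pFlux_le_picone {H : Type*} [NormedAddCommGroup H] [InnerProductSpace ℝ H]
    {p : ℝ} (hp : 1 < p) (a b : H) {h h' : ℝ} (hh : 0 ≤ h) (hh' : 2 * p * h ≤ h') :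
    h' / 2 * ⟪pFlux p a - pFlux p b, a - b⟫
      ≤ h * (p * ⟪b, pFlux p a⟫ + (1 - p) * ⟪a, pFlux p a⟫) + h' * ⟪a - b, pFlux p a⟫
        - (h * ⟪b, pFlux p b⟫ + h' * ⟪a - b, pFlux p b⟫) := by
  have hQ := inner_pFlux_sub_sub_nonneg hp a b
  have h1 := mul_le_mul_of_nonneg_left (inner_pFlux_le hp a b) hh
  have h2 := mul_le_mul_of_nonneg_right hh' hQ
  have ea := inner_pFlux_self hp a
  have eb := inner_pFlux_self hp b
  rw [← ea, ← eb] at h1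
  simp only [inner_sub_left, inner_sub_right, real_inner_comm (pFlux p a),
    real_inner_comm (pFlux p b)] at hQ h1 h2 ⊢
  nlinarith

section DiazSaa

variable {H : Type*} [NormedAddCommGroup H] [InnerProductSpace ℝ H]
  {p l : ℝ} {u v : H → ℝ} {x : H}

theorem hasFDerivAt_max_quotient_sub_one_sq (hu : DifferentiableAt ℝ u x)
    (hv : DifferentiableAt ℝ v x) (hux : 0 < u x) (hvx : 0 < v x) :
    HasFDerivAt (fun y => max (l⁻¹ * (u y * (v y)⁻¹) - 1) 0 ^ 2)
      ((2 * max (l⁻¹ * (u x * (v x)⁻¹) - 1) 0 * (l⁻¹ * (u x * (v x)⁻¹))) •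
        ((u x)⁻¹ • fderiv ℝ u x - (v x)⁻¹ • fderiv ℝ v x)) x := by
  have h1 := ((hu.hasFDerivAt.mul ((hasDerivAt_inv hvx.ne').comp_hasFDerivAt x
    hv.hasFDerivAt)).const_mul l⁻¹).sub_const 1
  refine ((hasDerivAt_max_zero_sq _).comp_hasFDerivAt x h1).congr_fderiv ?_
  ext y
  simp only [_root_.smul_apply, _root_.sub_apply, _root_.add_apply, smul_eq_mul,
    Function.comp, Pi.mul_apply]
  generalize max (l⁻¹ * (u x * (v x)⁻¹) - 1) 0 = m
  field_simp
  ring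

variable [CompleteSpace H]

theorem fderiv_picone_left (hu : DifferentiableAt ℝ u x)
    (hv : DifferentiableAt ℝ v x) (hux : 0 < u x) (hvx : 0 < v x) {g : H → ℝ} {t : ℝ}
    (hg : HasFDerivAt g (t • ((u x)⁻¹ • fderiv ℝ u x - (v x)⁻¹ • fderiv ℝ v x)) x) (y : H) :
    fderiv ℝ (fun z => v z ^ p * u z ^ (1 - p) * g z) x y
      = v x ^ p * u x ^ (1 - p) *
        (g x * (p * ⟪(v x)⁻¹ • gradient v x, y⟫ + (1 - p) * ⟪(u x)⁻¹ • gradient u x, y⟫)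
          + t * ⟪(u x)⁻¹ • gradient u x - (v x)⁻¹ • gradient v x, y⟫) := by
  have h1 := ((hv.hasFDerivAt.rpow_const (p := p) (Or.inl hvx.ne')).mul
    (hu.hasFDerivAt.rpow_const (p := 1 - p) (Or.inl hux.ne'))).mul hg
  have h2 : fderiv ℝ (fun z => v z ^ p * u z ^ (1 - p) * g z) x = _ := h1.fderiv
  rw [h2]
  simp only [_root_.smul_apply, _root_.sub_apply, _root_.add_apply, smul_eq_mul, Pi.mul_apply,
    inner_sub_left, real_inner_smul_left, inner_gradient_left, Real.rpow_sub_one hvx.ne',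
    Real.rpow_sub_one hux.ne']
  field_simp
  ring

theorem fderiv_picone_right (hv : DifferentiableAt ℝ v x) (hvx : 0 < v x) {g : H → ℝ} {t : ℝ}
    (hg : HasFDerivAt g (t • ((u x)⁻¹ • fderiv ℝ u x - (v x)⁻¹ • fderiv ℝ v x)) x) (y : H) :
    fderiv ℝ (fun z => v z * g z) x y
      = v x * (g x * ⟪(v x)⁻¹ • gradient v x, y⟫
          + t * ⟪(u x)⁻¹ • gradient u x - (v x)⁻¹ • gradient v x, y⟫) := by
  have h2 : fderiv ℝ (fun z => v z * g z) x = _ := (hv.hasFDerivAt.mul hg).fderiv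
  rw [h2]
  simp only [_root_.smul_apply, _root_.sub_apply, _root_.add_apply, smul_eq_mul,
    inner_sub_left, real_inner_smul_left, inner_gradient_left]
  field_simp
  ring

end DiazSaa

section Comparison

variable {d : ℕ} {p M l : ℝ} {V u v : EuclideanSpace ℝ (Fin d) → ℝ}
  {Ω U K : Set (EuclideanSpace ℝ (Fin d))}

/-- Díaz–Saá type identity: the logarithmic gradients of a subsolution `u` and a supersolution `v`
agree where `u / v` exceeds a level `l` close to `1`. -/
theorem IsWeakSupersol.logGradient_eq (h : IsWeakSupersol p V Ω v) (h' : IsWeakSubsol p V Ω u)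
    (hp : 1 < p) (hΩ : IsOpen Ω) (hV : Measurable V) (hM : ∀ x ∈ Ω, |V x| ≤ M)
    (hv : ContDiffOn ℝ 1 v Ω) (hu : ContDiffOn ℝ 1 u Ω) (hu0 : ∀ x ∈ Ω, 0 ≤ u x)
    (hle : ∀ x ∈ Ω, u x ≤ v x) (hU : IsOpen U) (hUΩ : U ⊆ Ω) (huU : ∀ x ∈ U, 0 < u x)
    (hK : IsCompact K) (hKU : K ⊆ U) (hl : 0 < l) (hpl : p * (1 - l) ≤ 1)
    (hKl : ∀ x ∈ U, x ∉ K → u x ≤ l * v x) :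
    ∀ x ∈ U, l * v x < u x → (u x)⁻¹ • gradient u x = (v x)⁻¹ • gradient v x := by
  have hv0 : ∀ x ∈ Ω, 0 ≤ v x := fun x hx => (hu0 x hx).trans (hle x hx)
  have hvU : ∀ x ∈ U, 0 < v x := fun x hx => (huU x hx).trans_le (hle x (hUΩ hx))
  have hu1 := hu.mono hUΩ
  have hv1 := hv.mono hUΩ
  have hud : ∀ x ∈ U, DifferentiableAt ℝ u x := fun x hx =>
    (hu1.differentiableOn one_ne_zero).differentiableAt (hU.mem_nhds hx)
  have hvd : ∀ x ∈ U, DifferentiableAt ℝ v x := fun x hx =>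
    (hv1.differentiableOn one_ne_zero).differentiableAt (hU.mem_nhds hx)
  set g : EuclideanSpace ℝ (Fin d) → ℝ := fun y => max (l⁻¹ * (u y * (v y)⁻¹) - 1) 0 ^ 2 with hg
  have hg1 : ContDiffOn ℝ 1 g U := contDiff_max_zero_sq.comp_contDiffOn
    ((contDiffOn_const.mul (hu1.mul (hv1.inv fun x hx => (hvU x hx).ne'))).sub contDiffOn_const)
  have hg0 : ∀ x, 0 ≤ g x := fun x => sq_nonneg _
  have hgK : ∀ x ∈ U, x ∉ K → g x = 0 := by
    intro x hx hxK
    have : l⁻¹ * (u x * (v x)⁻¹) ≤ 1 := by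
      rw [← div_eq_mul_inv, inv_mul_le_iff₀ hl, mul_one, div_le_iff₀ (hvU x hx)]
      exact hKl x hx hxK
    simp [hg, this]
  set φ : EuclideanSpace ℝ (Fin d) → ℝ := fun x => v x ^ p * u x ^ (1 - p) * g x with hφ
  set ψ : EuclideanSpace ℝ (Fin d) → ℝ := fun x => v x * g x with hψ
  have hφ1 : ContDiffOn ℝ 1 φ U := ((hv1.rpow_const_of_ne fun x hx => (hvU x hx).ne').mul
    (hu1.rpow_const_of_ne fun x hx => (huU x hx).ne')).mul hg1
  have hψ1 : ContDiffOn ℝ 1 ψ U := hv1.mul hg1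
  have hφ0 : ∀ x ∈ U, 0 ≤ φ x := fun x hx => mul_nonneg (mul_nonneg
    (Real.rpow_nonneg (hvU x hx).le _) (Real.rpow_nonneg (huU x hx).le _)) (hg0 x)
  have hψ0 : ∀ x ∈ U, 0 ≤ ψ x := fun x hx => mul_nonneg (hvU x hx).le (hg0 x)
  have hφK : ∀ x ∈ U, x ∉ K → φ x = 0 := fun x hx hxK => by simp [hφ, hgK x hx hxK]
  have hψK : ∀ x ∈ U, x ∉ K → ψ x = 0 := fun x hx hxK => by simp [hψ, hgK x hx hxK]
  have hMU : ∀ x ∈ U, |V x| ≤ M := fun x hx => hM x (hUΩ hx)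
  have i1 := integrableOn_weakForm hp hU hV hMU hu1 hφ1 hK hKU hφK
  have i2 := integrableOn_weakForm hp hU hV hMU hv1 hψ1 hK hKU hψK
  have hint := (h'.integral_nonpos hp hΩ hV hM hu hu0 hU hUΩ hφ1 hφ0 hK hKU hφK).trans
    (h.integral_nonneg hp hΩ hV hM hv hv0 hU hUΩ hψ1 hψ0 hK hKU hψK)
  rw [← sub_nonpos, ← integral_sub i1 i2] at hint
  set D : EuclideanSpace ℝ (Fin d) → ℝ := fun x =>
    fderiv ℝ φ x (pFlux p (gradient u x)) - fderiv ℝ ψ x (pFlux p (gradient v x)) with hD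
  have hDeq : ∀ x ∈ U, fderiv ℝ φ x (pFlux p (gradient u x)) + V x * u x ^ (p - 1) * φ x
      - (fderiv ℝ ψ x (pFlux p (gradient v x)) + V x * v x ^ (p - 1) * ψ x) = D x := by
    intro x hx
    have e1 : u x ^ (p - 1) * u x ^ (1 - p) = 1 := by
      rw [← Real.rpow_add (huU x hx)]; simp
    have e2 : v x ^ (p - 1) * v x = v x ^ p := rpow_sub_one_mul_self hp (hvU x hx).le
    have e3 : V x * u x ^ (p - 1) * φ x = V x * v x ^ (p - 1) * ψ x := by
      calc _ = V x * (u x ^ (p - 1) * u x ^ (1 - p)) * v x ^ p * g x := by simp only [hφ]; ring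
        _ = _ := by rw [e1, ← e2]; simp only [hψ]; ring
    rw [e3, hD]; ring
  have hDint : IntegrableOn D U :=
    (i1.sub i2).congr_fun hDeq hU.measurableSet
  rw [setIntegral_congr_fun hU.measurableSet hDeq] at hint
  have hlow : ∀ x ∈ U, v x ^ p * (max (l⁻¹ * (u x * (v x)⁻¹) - 1) 0 * (l⁻¹ * (u x * (v x)⁻¹)) *
      ⟪pFlux p ((u x)⁻¹ • gradient u x) - pFlux p ((v x)⁻¹ • gradient v x),
        (u x)⁻¹ • gradient u x - (v x)⁻¹ • gradient v x⟫) ≤ D x := by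
    intro x hx
    have hux := huU x hx
    have hvx := hvU x hx
    have hgd := hasFDerivAt_max_quotient_sub_one_sq (l := l) (hud x hx) (hvd x hx) hux hvx
    have e1 := fderiv_picone_left (p := p) (hud x hx) (hvd x hx) hux hvx hgd
      (pFlux p (gradient u x))
    have e2 := fderiv_picone_right (hvd x hx) hvx hgd (pFlux p (gradient v x))
    simp only [hD]
    rw [e1, e2]
    set s := l⁻¹ * (u x * (v x)⁻¹) with hs
    set a := (u x)⁻¹ • gradient u x with ha
    set b := (v x)⁻¹ • gradient v x with hb
    have ea : pFlux p (gradient u x) = u x ^ (p - 1) • pFlux p a := by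
      rw [← pFlux_smul hp hux.le, ha, smul_inv_smul₀ hux.ne']
    have eb : pFlux p (gradient v x) = v x ^ (p - 1) • pFlux p b := by
      rw [← pFlux_smul hp hvx.le, hb, smul_inv_smul₀ hvx.ne']
    have e3 : u x ^ (1 - p) * u x ^ (p - 1) = 1 := by
      rw [← Real.rpow_add hux]; simp
    have e4 : v x * v x ^ (p - 1) = v x ^ p := by
      rw [mul_comm, rpow_sub_one_mul_self hp hvx.le]
    have hsl : l * s ≤ 1 := by
      rw [hs, mul_inv_cancel_left₀ hl.ne', ← div_eq_mul_inv, div_le_one hvx]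
      exact hle x (hUΩ hx)
    have hs0 : 0 < s := by positivity
    have hh' : 2 * p * max (s - 1) 0 ^ 2 ≤ 2 * max (s - 1) 0 * s := by
      rcases le_total (s - 1) 0 with h | h
      · simp [max_eq_right h]
      · rw [max_eq_left h]
        have : p * (s - 1) ≤ s := by nlinarith
        nlinarith
    have key := mul_inner_pFlux_le_picone hp a b (sq_nonneg (max (s - 1) 0)) hh'
    have hvp : 0 < v x ^ p := Real.rpow_pos_of_pos hvx p
    calc _ = v x ^ p * (2 * max (s - 1) 0 * s / 2 * ⟪pFlux p a - pFlux p b, a - b⟫) := by ring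
      _ ≤ v x ^ p * _ := mul_le_mul_of_nonneg_left key hvp.le
      _ = _ := by
        rw [ea, eb]
        simp only [real_inner_smul_right]
        rw [mul_sub]
        congr 1
        · linear_combination -(v x ^ p * (max (s - 1) 0 ^ 2 * (p * ⟪b, pFlux p a⟫
            + (1 - p) * ⟪a, pFlux p a⟫) + 2 * max (s - 1) 0 * s * ⟪a - b, pFlux p a⟫)) * e3
        · linear_combination -(max (s - 1) 0 ^ 2 * ⟪b, pFlux p b⟫
            + 2 * max (s - 1) 0 * s * ⟪a - b, pFlux p b⟫) * e4
  have hDnonneg : ∀ x ∈ U, 0 ≤ D x := fun x hx => by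
    refine le_trans ?_ (hlow x hx)
    have h1 := inner_pFlux_sub_sub_nonneg hp ((u x)⁻¹ • gradient u x) ((v x)⁻¹ • gradient v x)
    have h2 := huU x hx
    have h3 := hvU x hx
    have h4 := le_max_right (l⁻¹ * (u x * (v x)⁻¹) - 1) 0
    positivity
  have hDcont : ContinuousOn D U :=
    ((hφ1.continuousOn_fderiv_of_isOpen hU le_rfl).clm_apply
      ((continuous_pFlux hp).comp_continuousOn (continuousOn_gradient hU hu1))).sub
    ((hψ1.continuousOn_fderiv_of_isOpen hU le_rfl).clm_apply
      ((continuous_pFlux hp).comp_continuousOn (continuousOn_gradient hU hv1)))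
  have hae : 0 ≤ᵐ[volume.restrict U] D := by
    filter_upwards [ae_restrict_mem hU.measurableSet] with x hx using hDnonneg x hx
  have hD0 : EqOn D 0 U := Measure.eqOn_open_of_ae_eq
    ((setIntegral_eq_zero_iff_of_nonneg_ae hae hDint).1
      (le_antisymm hint (setIntegral_nonneg hU.measurableSet hDnonneg)))
    hU hDcont continuousOn_const
  intro x hx hlx
  have hux := huU x hx
  have hvx := hvU x hx
  have hle0 := hlow x hx
  rw [hD0 hx] at hle0
  have hs1 : 1 < l⁻¹ * (u x * (v x)⁻¹) := by
    rw [← div_eq_mul_inv, lt_inv_mul_iff₀ hl, mul_one, lt_div_iff₀ hvx]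
    exact hlx
  rw [max_eq_left (by linarith)] at hle0
  refine eq_of_inner_pFlux_sub_sub_eq_zero hp (le_antisymm ?_ (inner_pFlux_sub_sub_nonneg hp _ _))
  by_contra! hQ
  refine hle0.not_gt ?_
  have h1 : 0 < l⁻¹ * (u x * (v x)⁻¹) - 1 := by linarith
  simp only [Pi.zero_apply]
  positivity

end Comparison

theorem exists_lt_one_forall_le_mul {X : Type*} [TopologicalSpace X] {K : Set X} {u v : X → ℝ}
    (hK : IsCompact K) (hu : ContinuousOn u K) (hv : ContinuousOn v K) (hv0 : ∀ x ∈ K, 0 < v x)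
    (hlt : ∀ x ∈ K, u x < v x) : ∃ m < 1, ∀ x ∈ K, u x ≤ m * v x := by
  rcases K.eq_empty_or_nonempty with rfl | hne
  · exact ⟨0, one_pos, by simp⟩
  · obtain ⟨x₀, hx₀, hmax⟩ := hK.exists_isMaxOn hne (hu.div hv fun x hx => (hv0 x hx).ne')
    exact ⟨u x₀ / v x₀, (div_lt_one (hv0 x₀ hx₀)).2 (hlt x₀ hx₀),
      fun x hx => (div_le_iff₀ (hv0 x hx)).1 (hmax hx)⟩

theorem fderiv_eq_of_gradient_eq {H : Type*} [NormedAddCommGroup H] [InnerProductSpace ℝ H]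
    [CompleteSpace H] {f g : H → ℝ} {x : H} (h : gradient f x = gradient g x) :
    fderiv ℝ f x = fderiv ℝ g x :=
  (InnerProductSpace.toDual ℝ H).symm.injective h

section StrongComparison

variable {d : ℕ} {p M : ℝ} {V u v : EuclideanSpace ℝ (Fin d) → ℝ}
  {Ω S : Set (EuclideanSpace ℝ (Fin d))}

theorem eqOn_of_gradient_eq_of_eqOn_diff (hd : 1 ≤ d) (hΩ : IsOpen Ω) (hv : ContDiffOn ℝ 1 v Ω)
    (hu : ContDiffOn ℝ 1 u Ω) (hS : IsCompact S) (hSΩ : S ⊆ Ω)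
    (hgrad : ∀ x ∈ Ω, gradient u x = gradient v x) (heq : ∀ x ∈ Ω \ S, u x = v x) :
    ∀ x ∈ Ω, u x = v x := by
  have : Nonempty (Fin d) := ⟨⟨0, hd⟩⟩
  have hw := hv.sub hu
  have hfd : Ω.EqOn (fderiv ℝ fun y => v y - u y) 0 := fun x hx => by
    rw [fderiv_fun_sub ((hv.differentiableOn one_ne_zero).differentiableAt (hΩ.mem_nhds hx))
      ((hu.differentiableOn one_ne_zero).differentiableAt (hΩ.mem_nhds hx)),
      fderiv_eq_of_gradient_eq (hgrad x hx), sub_self, Pi.zero_apply]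
  intro x₀ hx₀
  by_contra hne
  have hset : Ω ∩ (fun y => v y - u y) ⁻¹' {v x₀ - u x₀}
      = S ∩ (fun y => v y - u y) ⁻¹' {v x₀ - u x₀} := by
    refine Subset.antisymm (fun x hx => ⟨?_, hx.2⟩) (inter_subset_inter_left _ hSΩ)
    by_contra hxS
    have h1 := heq x ⟨hx.1, hxS⟩
    have h2 : v x - u x = v x₀ - u x₀ := hx.2
    exact hne (by linarith)
  refine not_isOpen_of_isCompact_of_nonempty
    (K := Ω ∩ (fun y => v y - u y) ⁻¹' {v x₀ - u x₀}) ?_ ⟨x₀, hx₀, rfl⟩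
    (hΩ.isOpen_inter_preimage_of_fderiv_eq_zero (hw.differentiableOn one_ne_zero) hfd _)
  rw [hset]
  exact hS.of_isClosed_subset ((hw.continuousOn.mono hSΩ).preimage_isClosed_of_isClosed
    hS.isClosed isClosed_singleton) inter_subset_left

theorem IsWeakSupersol.lt_of_lt_diff (h : IsWeakSupersol p V Ω v) (h' : IsWeakSubsol p V Ω u)
    (hd : 1 ≤ d) (hp : 1 < p) (hΩ : IsOpen Ω) (hV : Measurable V) (hM : ∀ x ∈ Ω, |V x| ≤ M)
    (hv : ContDiffOn ℝ 1 v Ω) (hu : ContDiffOn ℝ 1 u Ω) (hu0 : ∀ x ∈ Ω, 0 ≤ u x)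
    (hvpos : ∀ x ∈ Ω, 0 < v x) (hle : ∀ x ∈ Ω, u x ≤ v x) (hS : IsCompact S) (hSΩ : S ⊆ Ω)
    (hlt : ∀ x ∈ Ω \ S, u x < v x) : ∀ x ∈ Ω, u x < v x := by
  have : Nonempty (Fin d) := ⟨⟨0, hd⟩⟩
  obtain ⟨δ, hδ, hδΩ⟩ := hS.exists_cthickening_subset_open hΩ hSΩ
  have hP : IsCompact (cthickening δ S \ thickening (δ / 2) S) :=
    hS.cthickening.diff isOpen_thickening
  have hPΩ : cthickening δ S \ thickening (δ / 2) S ⊆ Ω := sdiff_subset.trans hδΩ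
  obtain ⟨m, hm, hmP⟩ := exists_lt_one_forall_le_mul hP (hu.continuousOn.mono hPΩ)
    (hv.continuousOn.mono hPΩ) (fun x hx => hvpos x (hPΩ hx)) fun x hx =>
    hlt x ⟨hPΩ hx, fun hxS => hx.2 (self_subset_thickening (half_pos hδ) S hxS)⟩
  set l := max (max m (1 - p⁻¹)) (1 / 2) with hl
  have hp0 : 0 < p := one_pos.trans hp
  have hml : m ≤ l := (le_max_left _ _).trans (le_max_left _ _)
  have hpl : 1 - p⁻¹ ≤ l := (le_max_right _ _).trans (le_max_left _ _)
  have hl0 : 0 < l := one_half_pos.trans_le (le_max_right _ _)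
  have hl1 : l < 1 := max_lt (max_lt hm (by linarith [inv_pos.2 hp0])) (by norm_num)
  have hpl' : p * (1 - l) ≤ 1 := by
    calc p * (1 - l) ≤ p * p⁻¹ := by gcongr; linarith
      _ = 1 := mul_inv_cancel₀ hp0.ne'
  set U := thickening δ S ∩ u ⁻¹' Ioi 0 with hU
  have hδΩ' : thickening δ S ⊆ Ω := (thickening_subset_cthickening δ S).trans hδΩ
  have hUo : IsOpen U :=
    (hu.continuousOn.mono hδΩ').isOpen_inter_preimage isOpen_thickening isOpen_Ioi
  have hUΩ : U ⊆ Ω := inter_subset_left.trans hδΩ'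
  set K := cthickening (δ / 2) S ∩ (fun x => u x - l * v x) ⁻¹' Ici 0 with hK
  have hhalf : cthickening (δ / 2) S ⊆ thickening δ S :=
    cthickening_subset_thickening' hδ (half_lt_self hδ) S
  have hKc : IsCompact K := by
    refine hS.cthickening.of_isClosed_subset (ContinuousOn.preimage_isClosed_of_isClosed ?_
      isClosed_cthickening isClosed_Ici) inter_subset_left
    exact ((hu.continuousOn.sub (continuousOn_const.mul hv.continuousOn))).mono
      (hhalf.trans hδΩ')
  have hKU : K ⊆ U := fun x hx => by
    have h1 := hhalf hx.1
    have h2 := mul_pos hl0 (hvpos x (hδΩ' h1))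
    have h3 : 0 ≤ u x - l * v x := hx.2
    exact ⟨h1, show 0 < u x by linarith⟩
  have hKl : ∀ x ∈ U, x ∉ K → u x ≤ l * v x := by
    intro x hx hxK
    by_cases hxt : x ∈ thickening (δ / 2) S
    · by_contra! hcon
      exact hxK ⟨thickening_subset_cthickening _ _ hxt, show 0 ≤ u x - l * v x by linarith⟩
    · exact (hmP x ⟨thickening_subset_cthickening _ _ hx.1, hxt⟩).trans
        (mul_le_mul_of_nonneg_right hml (hvpos x (hUΩ hx)).le)
  have hlog := h.logGradient_eq h' hp hΩ hV hM hv hu hu0 hle hUo hUΩ (fun x hx => hx.2) hKc hKU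
    hl0 hpl' hKl
  set W := U ∩ (fun x => u x - l * v x) ⁻¹' Ioi 0 with hW
  have hWo : IsOpen W := ((hu.continuousOn.sub
    (continuousOn_const.mul hv.continuousOn)).mono hUΩ).isOpen_inter_preimage hUo isOpen_Ioi
  have hder : ∀ x ∈ W, HasFDerivAt (fun y => Real.log (u y) - Real.log (v y))
      (0 : EuclideanSpace ℝ (Fin d) →L[ℝ] ℝ) x := by
    intro x hx
    have hxΩ := hΩ.mem_nhds (hUΩ hx.1)
    have hlx : 0 < u x - l * v x := hx.2
    have hux : 0 < u x := hx.1.2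
    have hgl := hlog x hx.1 (by linarith)
    refine ((((hu.differentiableOn one_ne_zero).differentiableAt hxΩ).hasFDerivAt.log
      hux.ne').sub (((hv.differentiableOn one_ne_zero).differentiableAt hxΩ).hasFDerivAt.log
      (hvpos x (hUΩ hx.1)).ne')).congr_fderiv ?_
    ext y
    have := congrArg (fun a => ⟪a, y⟫) hgl
    simp only [real_inner_smul_left, inner_gradient_left] at this
    simp [this]
  have hset : W ∩ (fun y => Real.log (u y) - Real.log (v y)) ⁻¹' {0}
      = S ∩ (fun y => v y - u y) ⁻¹' {0} := by
    ext x
    constructor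
    · rintro ⟨hx, hx0⟩
      have h1 : u x = v x := Real.log_injOn_pos (mem_Ioi.2 hx.1.2)
        (mem_Ioi.2 (hvpos x (hUΩ hx.1))) (sub_eq_zero.1 hx0)
      refine ⟨?_, sub_eq_zero.2 h1.symm⟩
      by_contra hxS
      exact (hlt x ⟨hUΩ hx.1, hxS⟩).ne h1
    · rintro ⟨hx, hx0⟩
      have h1 : v x = u x := sub_eq_zero.1 hx0
      have h2 := hvpos x (hSΩ hx)
      refine ⟨⟨⟨self_subset_thickening hδ S hx, ?_⟩, ?_⟩, ?_⟩
      · exact show 0 < u x from h1 ▸ h2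
      · show 0 < u x - l * v x
        rw [← h1]
        nlinarith
      · simp [h1]
  by_contra! hcon
  obtain ⟨x₀, hx₀, hvu⟩ := hcon
  have hx₀S : x₀ ∈ S := by
    by_contra hxS
    exact (hlt x₀ ⟨hx₀, hxS⟩).not_ge hvu
  refine not_isOpen_of_isCompact_of_nonempty (K := S ∩ (fun y => v y - u y) ⁻¹' {0}) ?_
    ⟨x₀, hx₀S, sub_eq_zero.2 (hvu.antisymm (hle x₀ hx₀))⟩ ?_
  · exact hS.of_isClosed_subset (((hv.continuousOn.sub hu.continuousOn).mono
      hSΩ).preimage_isClosed_of_isClosed hS.isClosed isClosed_singleton) inter_subset_left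
  · rw [← hset]
    exact hWo.isOpen_inter_preimage_of_fderiv_eq_zero
      (fun x hx => (hder x hx).differentiableAt.differentiableWithinAt)
      (fun x hx => (hder x hx).fderiv) _

end StrongComparison

theorem stmt8 (d : ℕ) (hd : 1 ≤ d) (p : ℝ) (hp : 1 < p)
    (Ω : Set (EuclideanSpace ℝ (Fin d))) (hΩopen : IsOpen Ω) (hΩbdd : Bornology.IsBounded Ω)
    (V : EuclideanSpace ℝ (Fin d) → ℝ) (hVmeas : Measurable V)
    (hVbdd : ∃ M : ℝ, ∀ x ∈ Ω, |V x| ≤ M)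
    (u v : EuclideanSpace ℝ (Fin d) → ℝ)
    (hu1 : ContDiffOn ℝ 1 u Ω) (hucont : ContinuousOn u (closure Ω))
    (hunn : ∀ x ∈ closure Ω, 0 ≤ u x)
    (hv1 : ContDiffOn ℝ 1 v Ω) (hvcont : ContinuousOn v (closure Ω))
    (hvnn : ∀ x ∈ closure Ω, 0 ≤ v x)
    (hvsuper : IsWeakSupersol p V Ω v) (husub : IsWeakSubsol p V Ω u)
    (hvbpos : ∀ x ∈ frontier Ω, 0 < v x)
    (hbdry : ∀ x ∈ frontier Ω, u x ≤ v x)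
    -- the common critical set
    (S : Set (EuclideanSpace ℝ (Fin d)))
    (hS : S = {x ∈ Ω | gradient u x = 0 ∧ gradient v x = 0})
    -- (i) the nondegeneracy set is connected
    (hconn : IsConnected (Ω \ S))
    -- (ii) the closure of `S` does not meet the boundary
    (hSfar : closure S ∩ frontier Ω = ∅)
    -- the weak comparison principle holds in `Ω`
    (WCP : ∀ ut vt : EuclideanSpace ℝ (Fin d) → ℝ,
      ContDiffOn ℝ 1 ut Ω → ContinuousOn ut (closure Ω) → (∀ x ∈ closure Ω, 0 ≤ ut x) →
      ContDiffOn ℝ 1 vt Ω → ContinuousOn vt (closure Ω) → (∀ x ∈ closure Ω, 0 ≤ vt x) →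
      IsWeakSupersol p V Ω vt → IsWeakSubsol p V Ω ut →
      (∀ x ∈ frontier Ω, ut x ≤ vt x) → ∀ x ∈ Ω, ut x ≤ vt x) :
    (∀ x ∈ Ω, u x < v x) ∨ (∀ x ∈ Ω, u x = v x) := by
  obtain ⟨M, hM⟩ := hVbdd
  have hle := WCP u v hu1 hucont hunn hv1 hvcont hvnn hvsuper husub hbdry
  have hvpos := hvsuper.pos_of_pos_on_frontier hd hp hΩopen hΩbdd hVmeas hM hv1 hvcont hvnn hvbpos
  have hu0 : ∀ x ∈ Ω, 0 ≤ u x := fun x hx => hunn x (subset_closure hx)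
  have hSΩ : S ⊆ Ω := by
    rw [hS]
    exact fun x hx => hx.1
  have hScl : ∀ x ∈ Ω, x ∈ closure S → x ∈ S := by
    intro x hx hxS
    have hfr : ∀ w : EuclideanSpace ℝ (Fin d) → ℝ, ContDiffOn ℝ 1 w Ω →
        (∀ y ∈ S, gradient w y = 0) → gradient w x = 0 := fun w hw hwS => by
      have hc := ((continuousOn_gradient hΩopen hw).continuousAt (hΩopen.mem_nhds hx))
      simpa using hc.continuousWithinAt.mem_closure hxS (t := {0})
        fun y hy => hwS y hy
    rw [hS] at hfr ⊢
    exact ⟨hx, hfr u hu1 fun y hy => hy.2.1, hfr v hv1 fun y hy => hy.2.2⟩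
  have hSc := isCompact_of_closure_inter_frontier_eq_empty hΩopen hΩbdd hSΩ hSfar hScl
  by_cases hT : ∃ x ∈ Ω \ S, u x = v x
  · right
    have ho1 : IsOpen (interior {x | u x = v x}) := isOpen_interior
    have ho2 : IsOpen (Ω ∩ (fun x => v x - u x) ⁻¹' Ioi 0) :=
      (hv1.continuousOn.sub hu1.continuousOn).isOpen_inter_preimage hΩopen isOpen_Ioi
    have hint : ∀ x ∈ Ω \ S, u x = v x → x ∈ interior {x | u x = v x} := by
      intro x hx hxe
      refine mem_interior_iff_mem_nhds.2 (hvsuper.eventually_eq_of_touching husub hp hΩopen hVmeas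
        hM hv1 hu1 hu0 hle hx.1 hxe (hvpos x hx.1) fun hg => hx.2 ?_)
      rw [hS]
      exact ⟨hx.1, (gradient_eq_of_touching hΩopen hv1 hu1 hle hx.1 hxe).trans hg, hg⟩
    have heq : ∀ x ∈ Ω \ S, u x = v x := by
      have hsub := hconn.isPreconnected.subset_left_of_subset_union ho1 ho2
        (disjoint_left.2 fun x hx1 hx2 => ?_) (fun x hx => ?_) ?_
      · exact fun x hx => interior_subset (s := {x | u x = v x}) (hsub hx)
      · have h1 : u x = v x := interior_subset (s := {x | u x = v x}) hx1
        have h2 : 0 < v x - u x := hx2.2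
        linarith
      · rcases (hle x hx.1).eq_or_lt with h | h
        · exact Or.inl (hint x hx h)
        · exact Or.inr ⟨hx.1, sub_pos.2 h⟩
      · obtain ⟨x, hx, hxe⟩ := hT
        exact ⟨x, hx, hint x hx hxe⟩
    refine eqOn_of_gradient_eq_of_eqOn_diff hd hΩopen hv1 hu1 hSc hSΩ (fun x hx => ?_) heq
    by_cases hxS : x ∈ S
    · rw [hS] at hxS
      rw [hxS.2.1, hxS.2.2]
    · exact gradient_eq_of_touching hΩopen hv1 hu1 hle hx (heq x ⟨hx, hxS⟩)
  · left
    push Not at hT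
    exact hvsuper.lt_of_lt_diff husub hd hp hΩopen hVmeas hM hv1 hu1 hu0 hvpos hle hSc hSΩ
      fun x hx => (hle x hx.1).lt_of_ne (hT x hx)
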